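/- arXiv:2304.04908 — 2 statements merged into one kernel-verified Lean document; each statement's English description precedes it below -/
import Mathlib

section
/- Let 1 ≤ l ≤ n−1 and i ∈ ℤ. (1) There is a unique algebra homomorphism φ : H_{mn}(ξ) → M_n(𝕜) with φ(a) = Z_{l,i}, φ(b) = diag(q^{i+l−1}, q^{i+l−2}, …, q^{i+l−n}), φ(c) = diag(ξ^i, ξ^{i+1}, …, ξ^{i+n−1}), φ(d) = D_n; the corresponding n-dimensional module T_1(l,i) is of (1,1)-type with soc T_1(l,i) ≅ M(l,i) and T_1(l,i)/soc T_1(l,i) ≅ M(n−l, i+l). (2) There is a unique algebra homomorphism φ : H_{mn}(ξ) → M_n(𝕜) with φ(a) = [[A_{n−l}(i+l−n), 0], [T_{l,n−l}, A_l(i)]], φ(b) = diag(q^{i−1}, q^{i−2}, …, q^{i−n}), φ(c) = diag(ξ^{i+l−n}, ξ^{i+l−n+1}, …, ξ^{i+l−1}), φ(d) = diag(D_{n−l}, D_l); the corresponding n-dimensional module T̄_1(l,i) is of (1,1)-type with soc T̄_1(l,i) ≅ M(l,i) and T̄_1(l,i)/soc T̄_1(l,i) ≅ M(n−l, i+l−n).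 -/
noncomputable section

namespace Radford

variable (𝕜 : Type) [Field 𝕜]

/-- The q-integer `(k)_q = 1 + q + ⋯ + q^(k-1)`. -/
def qInt (q : 𝕜) (k : ℕ) : 𝕜 := ∑ j ∈ Finset.range k, q ^ j

/-- The q-factorial `(k)!_q = (1)_q (2)_q ⋯ (k)_q`. -/
def qFact (q : 𝕜) : ℕ → 𝕜
  | 0 => 1
  | k + 1 => qFact q k * qInt 𝕜 q (k + 1)

variable (m n : ℕ) (ξ : 𝕜)

/-- Generators of the free algebra: 0 ↦ a, 1 ↦ b, 2 ↦ c, 3 ↦ d. -/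
def fgen (k : Fin 4) : FreeAlgebra 𝕜 (Fin 4) := FreeAlgebra.ι 𝕜 k

local notation "fa" => fgen 𝕜 0
local notation "fb" => fgen 𝕜 1
local notation "fc" => fgen 𝕜 2
local notation "fd" => fgen 𝕜 3

/-- The defining relations of the Drinfeld double `H_{mn}(ξ) = D(R_{mn}(q))`, where `q = ξ^m`. -/
inductive HRel : FreeAlgebra 𝕜 (Fin 4) → FreeAlgebra 𝕜 (Fin 4) → Prop
  | aPow : HRel (fa ^ n) (fb ^ n - 1)
  | bPow : HRel (fb ^ (m * n)) 1
  | cPow : HRel (fc ^ (m * n)) 1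
  | dPow : HRel (fd ^ n) 0
  | ab : HRel (fa * fb) (ξ ^ m • (fb * fa))
  | dc : HRel (fd * fc) (ξ • (fc * fd))
  | bc : HRel (fb * fc) (fc * fb)
  | bd : HRel (fb * fd) (ξ ^ m • (fd * fb))
  | ad : HRel (fa * fd - fd * fa) (fb - fc ^ m)
  | ac : HRel (fa * fc)
      (ξ⁻¹ • (fc * fa) +
        ((ξ⁻¹ - ξ ^ (n - 1)) / qFact 𝕜 (ξ ^ m) (n - 1)) •
          ((fc ^ (m + 1) - ξ ^ m • (fb * fc)) * fd ^ (n - 1)))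

/-- The Drinfeld double `H_{mn}(ξ)` of the Radford Hopf algebra `R_{mn}(q)`, presented by
generators `a, b, c, d` and the above relations. -/
def H := RingQuot (HRel 𝕜 m n ξ)

instance : Ring (H 𝕜 m n ξ) := inferInstanceAs (Ring (RingQuot (HRel 𝕜 m n ξ)))

instance : Algebra 𝕜 (H 𝕜 m n ξ) := inferInstanceAs (Algebra 𝕜 (RingQuot (HRel 𝕜 m n ξ)))

/-- The generators `a, b, c, d` of `H_{mn}(ξ)` (indexed by 0,1,2,3). -/
def gen (k : Fin 4) : H 𝕜 m n ξ := RingQuot.mkAlgHom 𝕜 (HRel 𝕜 m n ξ) (fgen 𝕜 k)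

local notation "ha" => gen 𝕜 m n ξ 0
local notation "hb" => gen 𝕜 m n ξ 1
local notation "hc" => gen 𝕜 m n ξ 2
local notation "hd" => gen 𝕜 m n ξ 3

/-- The Jacobson radical `J` of `H_{mn}(ξ)`. -/
def jrad : Ideal (H 𝕜 m n ξ) := Ideal.jacobson ⊥

/-- The scalars `α_k(l,i)`;  `alph l i k` is `α_k(l,i)`, where `q = ξ^m`. -/
def alph (l : ℕ) (i : ℤ) (k : ℕ) : 𝕜 :=
  if k = n then ((ξ ^ m) ^ (i + (l : ℤ)) - (ξ ^ m) ^ i) / qFact 𝕜 (ξ ^ m) (n - 1)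
  else qInt 𝕜 (ξ ^ m) k * ((ξ ^ m) ^ i - (ξ ^ m) ^ (i + (l : ℤ) - (k : ℤ)))

/-- The scalars `γ_k(l,i)`;  `gam l i k` is `γ_k(l,i)`, where `q = ξ^m`. -/
def gam (l : ℕ) (i : ℤ) (k : ℕ) : 𝕜 :=
  if k = n then ((ξ ^ m) ^ i - (ξ ^ m) ^ (i + (l : ℤ))) / qFact 𝕜 (ξ ^ m) (n - 1)
  else qInt 𝕜 (ξ ^ m) k * ((ξ ^ m) ^ (i + (l : ℤ)) - (ξ ^ m) ^ (i - (k : ℤ)))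

section ModuleH

variable {W : Type} [AddCommGroup W] [Module (H 𝕜 m n ξ) W]

variable (W) in
/-- The socle of an `H`-module: the sum of all simple submodules. -/
def socle : Submodule (H 𝕜 m n ξ) W :=
  sSup {N : Submodule (H 𝕜 m n ξ) W | IsSimpleModule (H 𝕜 m n ξ) N}

variable (W) in
/-- The submodule `J•W`, the radical of `W`. -/
def radM : Submodule (H 𝕜 m n ξ) W :=
  Submodule.span (H 𝕜 m n ξ) {x | ∃ r ∈ jrad 𝕜 m n ξ, ∃ w : W, x = r • w}

variable (W) in
/-- The submodule `J²•W`. -/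
def rad2M : Submodule (H 𝕜 m n ξ) W :=
  Submodule.span (H 𝕜 m n ξ)
    {x | ∃ r ∈ jrad 𝕜 m n ξ, ∃ s ∈ jrad 𝕜 m n ξ, ∃ w : W, x = r • s • w}

variable (W) in
/-- The submodule `J³•W`. -/
def rad3M : Submodule (H 𝕜 m n ξ) W :=
  Submodule.span (H 𝕜 m n ξ)
    {x | ∃ r ∈ jrad 𝕜 m n ξ, ∃ s ∈ jrad 𝕜 m n ξ, ∃ t ∈ jrad 𝕜 m n ξ, ∃ w : W, x = r • s • t • w}

variable (W) in
/-- `lengthIs c W` : the `H`-module `W` has a composition series of length `c`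
(hence, by Jordan–Hölder, has composition length `c`). -/
def lengthIs (c : ℕ) : Prop :=
  ∃ s : CompositionSeries (Submodule (H 𝕜 m n ξ) W), s.head = ⊥ ∧ s.last = ⊤ ∧ s.length = c

variable (W) in
/-- An `H`-module is indecomposable if it is nonzero and is not the direct sum of two
nonzero submodules. -/
def Indec : Prop :=
  Nontrivial W ∧ ∀ N₁ N₂ : Submodule (H 𝕜 m n ξ) W, IsCompl N₁ N₂ → N₁ = ⊥ ∨ N₂ = ⊥

variable (W) in
/-- `W` has Loewy length 2: `J•W ≠ 0` and `J²•W = 0`. -/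
def LoewyLen2 : Prop := radM 𝕜 m n ξ W ≠ ⊥ ∧ rad2M 𝕜 m n ξ W = ⊥

variable (W) in
/-- `W` is of `(s,t)`-type: it has Loewy length `2`, its socle has composition length `t`,
and `W/soc W` has composition length `s`. -/
def IsType (s t : ℕ) : Prop :=
  LoewyLen2 𝕜 m n ξ W ∧ lengthIs 𝕜 m n ξ (socle 𝕜 m n ξ W) t ∧
    lengthIs 𝕜 m n ξ (W ⧸ socle 𝕜 m n ξ W) s

end ModuleH

section ModuleK

variable {V : Type} [AddCommGroup V] [Module 𝕜 V] [Module (H 𝕜 m n ξ) V]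
  [IsScalarTower 𝕜 (H 𝕜 m n ξ) V]

variable (V) in
/-- `V^d = {v ∈ V | d•v = 0}`, as a `𝕜`-subspace. -/
def dKer : Submodule 𝕜 V where
  carrier := {v | hd • v = 0}
  add_mem' := by
    intro x y hx hy
    simp only [Set.mem_setOf_eq] at *
    rw [smul_add, hx, hy, add_zero]
  zero_mem' := smul_zero _
  smul_mem' := by
    intro r v hv
    simp only [Set.mem_setOf_eq] at *
    rw [smul_comm, hv, smul_zero]

variable (V) in
/-- `V_{(i)} = {v ∈ V | c•v = ξ^i v}`, as a `𝕜`-subspace. -/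
def eigsp (i : ℤ) : Submodule 𝕜 V where
  carrier := {v | hc • v = ξ ^ i • v}
  add_mem' := by
    intro x y hx hy
    simp only [Set.mem_setOf_eq] at *
    rw [smul_add, hx, hy, smul_add]
  zero_mem' := by simp
  smul_mem' := by
    intro r v hv
    simp only [Set.mem_setOf_eq] at *
    rw [smul_comm, hv, smul_comm]

/-- `V`, equipped with the family `mv : Fin l → V`, realizes the simple module `M(l,i)`:
`mv` is a basis of `V` and the generators act by the defining formulas of `M(l,i)`. -/
def IsMrep (l : ℕ) (i : ℤ) (mv : Fin l → V) : Prop :=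
  LinearIndependent 𝕜 mv ∧ Submodule.span 𝕜 (Set.range mv) = ⊤ ∧
  (∀ (j : ℕ) (hj : j + 1 < l),
    ha • mv ⟨j, by omega⟩ = alph 𝕜 m n ξ l i (j + 1) • mv ⟨j + 1, hj⟩) ∧
  (∀ (j : ℕ) (hj : j < l), j + 1 = l → ha • mv ⟨j, hj⟩ = 0) ∧
  (∀ j : Fin l, hb • mv j = ((ξ ^ m) ^ (i + (l : ℤ) - ((j : ℕ) + 1 : ℤ)) : 𝕜) • mv j) ∧
  (∀ j : Fin l, hc • mv j = (ξ ^ (i + (j : ℕ) : ℤ) : 𝕜) • mv j) ∧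
  (∀ (j : ℕ) (hj : j + 1 < l), hd • mv ⟨j + 1, hj⟩ = mv ⟨j, by omega⟩) ∧
  (∀ hl : 0 < l, hd • mv ⟨0, hl⟩ = 0)

/-- `V` realizes the induced module `Z(λ_{ij})`: there is a cyclic vector `z` with
`d•z = 0`, `b•z = ξ^j z`, `c•z = ξ^i z` such that `(a^k • z)_{0 ≤ k ≤ n-1}` is a basis. -/
def IsZrep (i j : ℤ) (V : Type) [AddCommGroup V] [Module 𝕜 V] [Module (H 𝕜 m n ξ) V]
    [IsScalarTower 𝕜 (H 𝕜 m n ξ) V] : Prop :=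
  ∃ z : V, hd • z = 0 ∧ hb • z = (ξ ^ j : 𝕜) • z ∧ hc • z = (ξ ^ i : 𝕜) • z ∧
    LinearIndependent 𝕜 (fun k : Fin n => (ha ^ (k : ℕ)) • z) ∧
    Submodule.span 𝕜 (Set.range fun k : Fin n => (ha ^ (k : ℕ)) • z) = ⊤

/-- `V`, equipped with the families `v u : Fin n → V`, realizes the projective module `P(l,i)`
with its standard basis. -/
def IsPrep (l : ℕ) (hl1 : 1 ≤ l) (hl2 : l < n) (i : ℤ) (v u : Fin n → V) : Prop :=
  LinearIndependent 𝕜 (Sum.elim v u) ∧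
  Submodule.span 𝕜 (Set.range v ∪ Set.range u) = ⊤ ∧
  (∀ (j : ℕ) (hj : j + l + 2 ≤ n),
    ha • v ⟨j, by omega⟩ = gam 𝕜 m n ξ l i (j + 1) • v ⟨j + 1, by omega⟩) ∧
  (∀ (j : ℕ) (hj : j + 1 < n), n ≤ j + 1 + l →
    ha • v ⟨j, by omega⟩ =
      gam 𝕜 m n ξ l i (j + 1) • v ⟨j + 1, hj⟩ + u ⟨j + 1 + l - n, by omega⟩) ∧
  (ha • v ⟨n - 1, by omega⟩ = gam 𝕜 m n ξ l i n • v ⟨0, by omega⟩ + u ⟨l, by omega⟩) ∧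
  (∀ (j : ℕ) (hj : j + 1 < n),
    ha • u ⟨j, by omega⟩ = alph 𝕜 m n ξ l i (j + 1) • u ⟨j + 1, hj⟩) ∧
  (ha • u ⟨n - 1, by omega⟩ = alph 𝕜 m n ξ l i n • u ⟨0, by omega⟩) ∧
  (∀ j : Fin n, hb • v j = ((ξ ^ m) ^ (i + (n : ℤ) - ((j : ℕ) + 1 : ℤ)) : 𝕜) • v j) ∧
  (∀ j : Fin n, hb • u j = ((ξ ^ m) ^ (i + (l : ℤ) - ((j : ℕ) + 1 : ℤ)) : 𝕜) • u j) ∧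
  (∀ j : Fin n, hc • v j = (ξ ^ (i - ((n : ℤ) - (l : ℤ)) + (j : ℕ) : ℤ) : 𝕜) • v j) ∧
  (∀ j : Fin n, hc • u j = (ξ ^ (i + (j : ℕ) : ℤ) : 𝕜) • u j) ∧
  (hd • v ⟨0, by omega⟩ = 0) ∧
  (∀ (j : ℕ) (hj : j + 1 < n), hd • v ⟨j + 1, hj⟩ = v ⟨j, by omega⟩) ∧
  (hd • u ⟨0, by omega⟩ = 0) ∧
  (∀ (j : ℕ) (hj : j + 1 < n), hd • u ⟨j + 1, hj⟩ = u ⟨j, by omega⟩)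

/-- `V`, equipped with the basis `e : Fin n → V`, realizes the module `T_1(l,i)`. -/
def IsT1rep (l : ℕ) (hl1 : 1 ≤ l) (hl2 : l < n) (i : ℤ) (e : Fin n → V) : Prop :=
  LinearIndependent 𝕜 e ∧ Submodule.span 𝕜 (Set.range e) = ⊤ ∧
  (∀ (j : ℕ) (hj : j + 1 < n),
    ha • e ⟨j, by omega⟩ = alph 𝕜 m n ξ l i (j + 1) • e ⟨j + 1, hj⟩) ∧
  (ha • e ⟨n - 1, by omega⟩ = alph 𝕜 m n ξ l i n • e ⟨0, by omega⟩) ∧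
  (∀ j : Fin n, hb • e j = ((ξ ^ m) ^ (i + (l : ℤ) - ((j : ℕ) + 1 : ℤ)) : 𝕜) • e j) ∧
  (∀ j : Fin n, hc • e j = (ξ ^ (i + (j : ℕ) : ℤ) : 𝕜) • e j) ∧
  (hd • e ⟨0, by omega⟩ = 0) ∧
  (∀ (j : ℕ) (hj : j + 1 < n), hd • e ⟨j + 1, hj⟩ = e ⟨j, by omega⟩)

/-- `V`, equipped with the basis `e : Fin n → V`, realizes the module `T̄_1(l,i)`. -/
def IsT1barrep (l : ℕ) (hl1 : 1 ≤ l) (hl2 : l < n) (i : ℤ) (e : Fin n → V) : Prop :=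
  LinearIndependent 𝕜 e ∧ Submodule.span 𝕜 (Set.range e) = ⊤ ∧
  (∀ (j : ℕ) (hj : j + 1 < n - l),
    ha • e ⟨j, by omega⟩ = alph 𝕜 m n ξ (n - l) (i + l - n) (j + 1) • e ⟨j + 1, by omega⟩) ∧
  (ha • e ⟨n - l - 1, by omega⟩ = e ⟨n - l, by omega⟩) ∧
  (∀ (k : ℕ) (hk : k + 1 < l),
    ha • e ⟨n - l + k, by omega⟩ = alph 𝕜 m n ξ l i (k + 1) • e ⟨n - l + k + 1, by omega⟩) ∧
  (ha • e ⟨n - 1, by omega⟩ = 0) ∧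
  (∀ j : Fin n, hb • e j = ((ξ ^ m) ^ (i - ((j : ℕ) + 1 : ℤ)) : 𝕜) • e j) ∧
  (∀ j : Fin n, hc • e j = (ξ ^ (i + (l : ℤ) - (n : ℤ) + (j : ℕ) : ℤ) : 𝕜) • e j) ∧
  (hd • e ⟨0, by omega⟩ = 0) ∧
  (∀ (j : ℕ) (hj : j + 1 < n - l), hd • e ⟨j + 1, by omega⟩ = e ⟨j, by omega⟩) ∧
  (hd • e ⟨n - l, by omega⟩ = 0) ∧
  (∀ (k : ℕ) (hk : k + 1 < l), hd • e ⟨n - l + k + 1, by omega⟩ = e ⟨n - l + k, by omega⟩)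

end ModuleK

section Matrices

/-- The nilpotent Jordan-type matrix `D_s` with `1` on the superdiagonal. -/
def Dmat (s : ℕ) : Matrix (Fin s) (Fin s) 𝕜 :=
  fun r c => if (r : ℕ) + 1 = (c : ℕ) then 1 else 0

/-- The matrix `X_{l,i}` : subdiagonal entries `γ_k(l,i)`, `(1,n)`-entry `γ_n(l,i)`. -/
def Xmat (l : ℕ) (i : ℤ) : Matrix (Fin n) (Fin n) 𝕜 := fun r c =>
  if (r : ℕ) = (c : ℕ) + 1 then gam 𝕜 m n ξ l i ((c : ℕ) + 1)
  else if (r : ℕ) = 0 ∧ (c : ℕ) = n - 1 then gam 𝕜 m n ξ l i n else 0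

/-- The matrix `Z_{l,i}` : subdiagonal entries `α_k(l,i)`, `(1,n)`-entry `α_n(l,i)`. -/
def Zmat (l : ℕ) (i : ℤ) : Matrix (Fin n) (Fin n) 𝕜 := fun r c =>
  if (r : ℕ) = (c : ℕ) + 1 then alph 𝕜 m n ξ l i ((c : ℕ) + 1)
  else if (r : ℕ) = 0 ∧ (c : ℕ) = n - 1 then alph 𝕜 m n ξ l i n else 0

/-- The block matrix `A(l,i) = [[X_{l,i}, 0], [D_n^{n-l-1}, Z_{l,i}]]`. -/
def Amat (l : ℕ) (i : ℤ) : Matrix (Fin n ⊕ Fin n) (Fin n ⊕ Fin n) 𝕜 :=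
  Matrix.fromBlocks (Xmat 𝕜 m n ξ l i) 0 (Dmat 𝕜 n ^ (n - l - 1)) (Zmat 𝕜 m n ξ l i)

/-- The diagonal matrix `B(l,i)`. -/
def Bmat (l : ℕ) (i : ℤ) : Matrix (Fin n ⊕ Fin n) (Fin n ⊕ Fin n) 𝕜 :=
  Matrix.fromBlocks
    (Matrix.diagonal fun j : Fin n => (ξ ^ m) ^ (i - ((j : ℕ) + 1 : ℤ))) 0 0
    (Matrix.diagonal fun j : Fin n => (ξ ^ m) ^ (i + (l : ℤ) - ((j : ℕ) + 1 : ℤ)))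

/-- The diagonal matrix `C(l,i)`. -/
def Cmat (l : ℕ) (i : ℤ) : Matrix (Fin n ⊕ Fin n) (Fin n ⊕ Fin n) 𝕜 :=
  Matrix.fromBlocks
    (Matrix.diagonal fun j : Fin n => ξ ^ (i + (l : ℤ) - (n : ℤ) + (j : ℕ))) 0 0
    (Matrix.diagonal fun j : Fin n => ξ ^ (i + (j : ℕ) : ℤ))

/-- The block matrix `D = diag(D_n, D_n)`. -/
def Dbig : Matrix (Fin n ⊕ Fin n) (Fin n ⊕ Fin n) 𝕜 :=
  Matrix.fromBlocks (Dmat 𝕜 n) 0 0 (Dmat 𝕜 n)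

end Matrices

theorem fg_adjoin_insert {A : Type} [Ring A] [Algebra 𝕜 A] (s : Set A) (x : A) (k : ℕ)
    (hk : 0 < k) (hs : (Algebra.adjoin 𝕜 s).toSubmodule.FG) (hxk : x ^ k ∈ Algebra.adjoin 𝕜 s)
    (hx : ∀ g ∈ s, ∃ u ∈ Algebra.adjoin 𝕜 s, ∃ v ∈ Algebra.adjoin 𝕜 s, x * g = u * x + v) :
    (Algebra.adjoin 𝕜 (insert x s)).toSubmodule.FG := by
  set U := Algebra.adjoin 𝕜 s with hU
  have hcomm : ∀ g ∈ U, ∃ u ∈ U, ∃ v ∈ U, x * g = u * x + v := by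
    intro g hg
    induction hg using Algebra.adjoin_induction with
    | mem g hg => exact hx g hg
    | algebraMap r =>
      exact ⟨_, U.algebraMap_mem r, 0, U.zero_mem, by rw [Algebra.commutes, add_zero]⟩
    | add g h _ _ ihg ihh =>
      obtain ⟨u, hu, v, hv, e⟩ := ihg
      obtain ⟨u', hu', v', hv', e'⟩ := ihh
      exact ⟨_, U.add_mem hu hu', _, U.add_mem hv hv', by rw [mul_add, e, e', add_mul]; abel⟩
    | mul g h _ hh ihg ihh =>
      obtain ⟨u, hu, v, hv, e⟩ := ihg
      obtain ⟨u', hu', v', hv', e'⟩ := ihh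
      refine ⟨_, U.mul_mem hu hu', _, U.add_mem (U.mul_mem hu hv') (U.mul_mem hv hh), ?_⟩
      rw [← mul_assoc, e, add_mul, mul_assoc, e']
      noncomm_ring
  set P : Submodule 𝕜 A := Submodule.span 𝕜 ((fun w : ℕ => x ^ w) '' Set.Iio k) with hP
  set T : Submodule 𝕜 A := U.toSubmodule * P with hT
  have hPFG : P.FG := Submodule.fg_span ((Set.finite_Iio k).image _)
  have hmem : ∀ u ∈ U, ∀ w < k, u * x ^ w ∈ T := fun u hu w hw =>
    Submodule.mul_mem_mul hu (Submodule.subset_span ⟨w, hw, rfl⟩)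
  have hmem' : ∀ u ∈ U, ∀ w ≤ k, u * x ^ w ∈ T := by
    intro u hu w hw
    rcases hw.lt_or_eq with h | rfl
    · exact hmem u hu w h
    · simpa using hmem _ (U.mul_mem hu hxk) 0 hk
  have hind : ∀ (f : A →ₗ[𝕜] A), (∀ u ∈ U, ∀ w < k, f (u * x ^ w) ∈ T) →
      ∀ t ∈ T, f t ∈ T := by
    intro f hf t ht
    have hle : T ≤ T.comap f := by
      refine Submodule.mul_le.2 fun u hu p hp => ?_
      change f (u * p) ∈ T
      induction hp using Submodule.span_induction with
      | mem p hp => obtain ⟨w, hw, rfl⟩ := hp; exact hf u hu w hw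
      | zero => simp
      | add p p' _ _ h h' => rw [mul_add, map_add]; exact T.add_mem h h'
      | smul r p _ h => rw [mul_smul_comm, map_smul]; exact T.smul_mem r h
    exact hle ht
  refine Submodule.FG.of_le (hs.mul hPFG) fun y hy => ?_
  suffices ∀ t ∈ T, y * t ∈ T by
    simpa using this 1 (by simpa using hmem 1 U.one_mem 0 hk)
  have hy' : y ∈ Algebra.adjoin 𝕜 (insert x s) := hy
  clear hy
  induction hy' using Algebra.adjoin_induction with
  | mem g hg =>
    refine hind (LinearMap.mulLeft 𝕜 g) fun u hu w hw => ?_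
    rw [LinearMap.mulLeft_apply]
    rcases hg with rfl | hg
    · obtain ⟨u', hu', v, hv, e⟩ := hcomm u hu
      rw [← mul_assoc, e, add_mul, mul_assoc, ← pow_succ']
      exact T.add_mem (hmem' _ hu' _ hw) (hmem _ hv _ hw)
    · rw [← mul_assoc]
      exact hmem _ (U.mul_mem (Algebra.subset_adjoin hg) hu) w hw
  | algebraMap r => intro t ht; rw [← Algebra.smul_def]; exact T.smul_mem r ht
  | add g h _ _ ihg ihh => intro t ht; rw [add_mul]; exact T.add_mem (ihg t ht) (ihh t ht)
  | mul g h _ _ ihg ihh => intro t ht; rw [mul_assoc]; exact ihg _ (ihh t ht)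

/-- The quotient map from the free algebra onto `H_{mn}(ξ)`. -/
def toH : FreeAlgebra 𝕜 (Fin 4) →ₐ[𝕜] H 𝕜 m n ξ := RingQuot.mkAlgHom 𝕜 (HRel 𝕜 m n ξ)

theorem toH_fgen (k : Fin 4) : toH 𝕜 m n ξ (fgen 𝕜 k) = gen 𝕜 m n ξ k := rfl

theorem toH_eq_of_rel {x y : FreeAlgebra 𝕜 (Fin 4)} (h : HRel 𝕜 m n ξ x y) :
    toH 𝕜 m n ξ x = toH 𝕜 m n ξ y :=
  RingQuot.mkAlgHom_rel 𝕜 h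

theorem adjoin_range_gen : Algebra.adjoin 𝕜 (Set.range (gen 𝕜 m n ξ)) = ⊤ := by
  have : Set.range (gen 𝕜 m n ξ) =
      toH 𝕜 m n ξ '' Set.range (FreeAlgebra.ι 𝕜 : Fin 4 → FreeAlgebra 𝕜 (Fin 4)) := by
    rw [← Set.range_comp]; rfl
  rw [this, ← AlgHom.map_adjoin, FreeAlgebra.adjoin_range_ι, Algebra.map_top,
    AlgHom.range_eq_top]
  exact RingQuot.mkAlgHom_surjective 𝕜 _

theorem exists_lift {B : Type} [Ring B] [Algebra 𝕜 B] (x : Fin 4 → B)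
    (h : ∀ u v, HRel 𝕜 m n ξ u v → FreeAlgebra.lift 𝕜 x u = FreeAlgebra.lift 𝕜 x v) :
    ∃ φ : H 𝕜 m n ξ →ₐ[𝕜] B, ∀ k, φ (gen 𝕜 m n ξ k) = x k := by
  refine ⟨RingQuot.liftAlgHom 𝕜 ⟨FreeAlgebra.lift 𝕜 x, fun u v huv => h u v huv⟩, fun k => ?_⟩
  exact (RingQuot.liftAlgHom_mkAlgHom_apply 𝕜 _ _ _).trans (FreeAlgebra.lift_ι_apply _ _)

theorem hom_ext_gen {B : Type} [Ring B] [Algebra 𝕜 B] {φ ψ : H 𝕜 m n ξ →ₐ[𝕜] B}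
    (h : ∀ k, φ (gen 𝕜 m n ξ k) = ψ (gen 𝕜 m n ξ k)) : φ = ψ :=
  AlgHom.ext_of_adjoin_eq_top (adjoin_range_gen 𝕜 m n ξ) (by rintro _ ⟨k, rfl⟩; exact h k)

theorem finite_H (hm : 0 < m) (hn : 0 < n) (hξ : ξ ≠ 0) : Module.Finite 𝕜 (H 𝕜 m n ξ) := by
  have hmn : 0 < m * n := Nat.mul_pos hm hn
  have aPow : ha ^ n = hb ^ n - 1 := by
    simpa [toH_fgen] using toH_eq_of_rel 𝕜 m n ξ HRel.aPow
  have bPow : hb ^ (m * n) = 1 := by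
    simpa [toH_fgen] using toH_eq_of_rel 𝕜 m n ξ HRel.bPow
  have cPow : hc ^ (m * n) = 1 := by
    simpa [toH_fgen] using toH_eq_of_rel 𝕜 m n ξ HRel.cPow
  have dPow : hd ^ n = 0 := by
    simpa [toH_fgen] using toH_eq_of_rel 𝕜 m n ξ HRel.dPow
  have ab : ha * hb = ξ ^ m • (hb * ha) := by
    simpa [toH_fgen] using toH_eq_of_rel 𝕜 m n ξ HRel.ab
  have dc : hd * hc = ξ • (hc * hd) := by
    simpa [toH_fgen] using toH_eq_of_rel 𝕜 m n ξ HRel.dc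
  have bc : hb * hc = hc * hb := by
    simpa [toH_fgen] using toH_eq_of_rel 𝕜 m n ξ HRel.bc
  have bd : hb * hd = ξ ^ m • (hd * hb) := by
    simpa [toH_fgen] using toH_eq_of_rel 𝕜 m n ξ HRel.bd
  have ad : ha * hd - hd * ha = hb - hc ^ m := by
    simpa [toH_fgen] using toH_eq_of_rel 𝕜 m n ξ HRel.ad
  have ac : ha * hc = ξ⁻¹ • (hc * ha) + ((ξ⁻¹ - ξ ^ (n - 1)) / qFact 𝕜 (ξ ^ m) (n - 1)) •
      ((hc ^ (m + 1) - ξ ^ m • (hb * hc)) * hd ^ (n - 1)) := by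
    simpa only [map_mul, map_add, map_sub, map_smul, map_pow, toH_fgen] using
      toH_eq_of_rel 𝕜 m n ξ HRel.ac
  have sub {s : Set (H 𝕜 m n ξ)} {x} (h : x ∈ s) : x ∈ Algebra.adjoin 𝕜 s :=
    Algebra.subset_adjoin h
  have h0 : (Algebra.adjoin 𝕜 (∅ : Set (H 𝕜 m n ξ))).toSubmodule.FG := by
    rw [Algebra.adjoin_empty, Algebra.toSubmodule_bot, Submodule.one_eq_span]
    exact Submodule.fg_span_singleton _
  have h1 := fg_adjoin_insert 𝕜 ∅ hb _ hmn h0 (by rw [bPow]; exact one_mem _) (by simp)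
  have h2 := fg_adjoin_insert 𝕜 _ hc _ hmn h1 (by rw [cPow]; exact one_mem _) (by
    rintro _ (rfl | h)
    · exact ⟨hb, sub (by simp), 0, zero_mem _, by rw [bc, add_zero]⟩
    · exact h.elim)
  have db : hd * hb = (ξ ^ m)⁻¹ • (hb * hd) := by
    rw [bd, smul_smul, inv_mul_cancel₀ (pow_ne_zero m hξ), one_smul]
  have h3 := fg_adjoin_insert 𝕜 _ hd _ hn h2 (by rw [dPow]; exact zero_mem _) (by
    rintro _ (rfl | rfl | h)
    · exact ⟨ξ • hc, Subalgebra.smul_mem _ (sub (by simp)) _, 0, zero_mem _, by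
        rw [dc, add_zero, smul_mul_assoc]⟩
    · exact ⟨(ξ ^ m)⁻¹ • hb, Subalgebra.smul_mem _ (sub (by simp)) _, 0, zero_mem _, by
        rw [db, add_zero, smul_mul_assoc]⟩
    · exact h.elim)
  have memB : hb ∈ Algebra.adjoin 𝕜 (insert hd (insert hc (insert hb ∅))) := sub (by simp)
  have memC : hc ∈ Algebra.adjoin 𝕜 (insert hd (insert hc (insert hb ∅))) := sub (by simp)
  have memD : hd ∈ Algebra.adjoin 𝕜 (insert hd (insert hc (insert hb ∅))) := sub (by simp)
  have h4 := fg_adjoin_insert 𝕜 _ ha _ hn h3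
    (by rw [aPow]; exact sub_mem (pow_mem memB n) (one_mem _)) (by
    rintro _ (rfl | rfl | rfl | h)
    · exact ⟨hd, memD, _, sub_mem memB (pow_mem memC m), by rw [← ad]; abel⟩
    · exact ⟨ξ⁻¹ • hc, Subalgebra.smul_mem _ memC _, _,
        Subalgebra.smul_mem _ (mul_mem (sub_mem (pow_mem memC _)
          (Subalgebra.smul_mem _ (mul_mem memB memC) _)) (pow_mem memD _)) _, by
        rw [ac, smul_mul_assoc]⟩
    · exact ⟨ξ ^ m • hb, Subalgebra.smul_mem _ memB _, 0, zero_mem _, by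
        rw [ab, add_zero, smul_mul_assoc]⟩
    · exact h.elim)
  refine ⟨?_⟩
  rw [← Algebra.top_toSubmodule, ← adjoin_range_gen]
  have hrange : Set.range (gen 𝕜 m n ξ) = insert ha (insert hd (insert hc (insert hb ∅))) := by
    ext x
    simp only [Set.mem_range, Fin.exists_fin_succ, Set.mem_insert_iff, Set.mem_empty_iff_false]
    simp [eq_comm]
    tauto
  rw [hrange]
  exact h4

section Structure

variable {V : Type} [AddCommGroup V] [Module (H 𝕜 m n ξ) V]

theorem lengthIs_one [IsSimpleModule (H 𝕜 m n ξ) V] : lengthIs 𝕜 m n ξ V 1 := by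
  refine ⟨⟨1, ![⊥, ⊤], fun k => ?_⟩, by simp [RelSeries.head], by simp [RelSeries.last], rfl⟩
  fin_cases k
  exact (bot_covBy_top : (⊥ : Submodule (H 𝕜 m n ξ) V) ⋖ ⊤)

theorem socle_eq_of_simple (S : Submodule (H 𝕜 m n ξ) V) (hS : IsSimpleModule (H 𝕜 m n ξ) S)
    (hQ : IsSimpleModule (H 𝕜 m n ξ) (V ⧸ S)) (hN : ∀ N, ¬ IsCompl S N) :
    socle 𝕜 m n ξ V = S := by
  refine le_antisymm (sSup_le fun N hN' => ?_) (le_sSup hS)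
  have hat := isSimpleModule_iff_isAtom.1 hN'
  have hco := isSimpleModule_iff_isCoatom.1 hQ
  by_contra hle
  refine hN N ⟨?_, ?_⟩
  · exact (hat.not_le_iff_disjoint.1 hle).symm
  · exact hco.not_le_iff_codisjoint.1 hle

theorem jrad_smul_simple [IsSimpleModule (H 𝕜 m n ξ) V] {r : H 𝕜 m n ξ}
    (hr : r ∈ jrad 𝕜 m n ξ) (v : V) : r • v = 0 := by
  rw [jrad, Ideal.jacobson_bot] at hr
  exact Module.mem_annihilator.1
    (IsSemisimpleModule.jacobson_le_annihilator (H 𝕜 m n ξ) V hr) v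

theorem isSemisimple_of_radM_eq_bot [IsArtinianRing (H 𝕜 m n ξ)]
    (h : radM 𝕜 m n ξ V = ⊥) : IsSemisimpleModule (H 𝕜 m n ξ) V := by
  have ht : Module.IsTorsionBySet (H 𝕜 m n ξ) V (Ring.jacobson (H 𝕜 m n ξ)) := by
    rintro v ⟨r, hr⟩
    rw [SetLike.mem_coe, ← Ideal.jacobson_bot] at hr
    have hv : r • v ∈ radM 𝕜 m n ξ V := Submodule.subset_span ⟨r, hr, v, rfl⟩
    rwa [h, Submodule.mem_bot] at hv
  let _ := ht.module
  exact ht.isSemisimpleModule_iff.1 inferInstance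

theorem isType_of_simple [IsArtinianRing (H 𝕜 m n ξ)] (S : Submodule (H 𝕜 m n ξ) V)
    (hS : IsSimpleModule (H 𝕜 m n ξ) S)
    (hQ : IsSimpleModule (H 𝕜 m n ξ) (V ⧸ S)) (hN : ∀ N, ¬ IsCompl S N) :
    IsType 𝕜 m n ξ V 1 1 := by
  refine ⟨⟨fun h => ?_, ?_⟩, ?_⟩
  · have := isSemisimple_of_radM_eq_bot 𝕜 m n ξ h
    obtain ⟨N, hN'⟩ := exists_isCompl S
    exact hN N hN'
  · rw [rad2M, Submodule.span_eq_bot]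
    rintro _ ⟨r, hr, s, hs, w, rfl⟩
    have hsw : s • w ∈ S := by
      rw [← Submodule.Quotient.mk_eq_zero, Submodule.Quotient.mk_smul]
      exact jrad_smul_simple 𝕜 m n ξ hs _
    exact congrArg Subtype.val (jrad_smul_simple 𝕜 m n ξ hr (⟨s • w, hsw⟩ : S))
  · rw [socle_eq_of_simple 𝕜 m n ξ S hS hQ hN]
    exact ⟨lengthIs_one 𝕜 m n ξ, lengthIs_one 𝕜 m n ξ⟩

theorem not_isCompl_of_smul (S : Submodule (H 𝕜 m n ξ) V) (x : H 𝕜 m n ξ)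
    (hx : ∀ s ∈ S, x • s = 0) (v : V) (hv : x • v ∈ S) (hv0 : x • v ≠ 0)
    (N : Submodule (H 𝕜 m n ξ) V) : ¬ IsCompl S N := by
  intro h
  obtain ⟨s, hs, t, ht, rfl⟩ := Submodule.mem_sup.1
    (show v ∈ S ⊔ N by rw [h.sup_eq_top]; trivial)
  rw [smul_add, hx s hs, zero_add] at hv hv0
  exact hv0 ((Submodule.disjoint_def.1 h.disjoint) _ hv (N.smul_mem x ht))

variable [Module 𝕜 V]

/-- The formulas by which the generators act on the basis of `M(l,i)`. -/
def IsMact (l : ℕ) (i : ℤ) (mv : Fin l → V) : Prop :=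
  (∀ (j : ℕ) (hj : j + 1 < l),
    ha • mv ⟨j, by omega⟩ = alph 𝕜 m n ξ l i (j + 1) • mv ⟨j + 1, hj⟩) ∧
  (∀ (j : ℕ) (hj : j < l), j + 1 = l → ha • mv ⟨j, hj⟩ = 0) ∧
  (∀ j : Fin l, hb • mv j = ((ξ ^ m) ^ (i + (l : ℤ) - ((j : ℕ) + 1 : ℤ)) : 𝕜) • mv j) ∧
  (∀ j : Fin l, hc • mv j = (ξ ^ (i + (j : ℕ) : ℤ) : 𝕜) • mv j) ∧
  (∀ (j : ℕ) (hj : j + 1 < l), hd • mv ⟨j + 1, hj⟩ = mv ⟨j, by omega⟩) ∧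
  (∀ hl : 0 < l, hd • mv ⟨0, hl⟩ = 0)

variable {𝕜 m n ξ} in
theorem IsMact.gen_smul_mem {l : ℕ} {i : ℤ} {mv : Fin l → V} (h : IsMact 𝕜 m n ξ l i mv)
    (k : Fin 4) (j : Fin l) : gen 𝕜 m n ξ k • mv j ∈ Submodule.span 𝕜 (Set.range mv) := by
  obtain ⟨h1, h2, h3, h4, h5, h6⟩ := h
  have hmem (j) : mv j ∈ Submodule.span 𝕜 (Set.range mv) := Submodule.subset_span ⟨j, rfl⟩
  obtain ⟨j, hj⟩ := j
  fin_cases k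
  · rcases Nat.lt_or_eq_of_le (Nat.succ_le_of_lt hj) with hl | hl
    · exact h1 j hl ▸ Submodule.smul_mem _ _ (hmem _)
    · exact h2 j hj hl ▸ zero_mem _
  · exact h3 ⟨j, hj⟩ ▸ Submodule.smul_mem _ _ (hmem _)
  · exact h4 ⟨j, hj⟩ ▸ Submodule.smul_mem _ _ (hmem _)
  · cases j with
    | zero => exact h6 hj ▸ zero_mem _
    | succ j => exact h5 j hj ▸ hmem _

variable {𝕜 m n ξ} in
theorem IsMact.d_pow_smul {l : ℕ} {i : ℤ} {mv : Fin l → V} (h : IsMact 𝕜 m n ξ l i mv)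
    (p k : ℕ) (hk : k < l) :
    hd ^ p • mv ⟨k, hk⟩ = if p ≤ k then mv ⟨k - p, by omega⟩ else 0 := by
  obtain ⟨-, -, -, -, h5, h6⟩ := h
  induction p with
  | zero => simp
  | succ p ih =>
    rw [pow_succ', mul_smul, ih]
    rcases lt_trichotomy p k with hp | rfl | hp
    · obtain ⟨t, rfl⟩ : ∃ t, k = p + (t + 1) := ⟨k - p - 1, by omega⟩
      rw [if_pos hp.le, if_pos (by omega)]
      have := h5 t (by omega)
      simp only [show p + (t + 1) - p = t + 1 by omega, show p + (t + 1) - (p + 1) = t by omega]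
      exact this
    · rw [if_pos le_rfl, if_neg (by omega)]
      simpa using h6 (by omega)
    · rw [if_neg (by omega), if_neg (by omega), smul_zero]

variable [IsScalarTower 𝕜 (H 𝕜 m n ξ) V]

theorem exists_submodule_of_gen_smul_mem (T : Submodule 𝕜 V)
    (hT : ∀ k, ∀ v ∈ T, gen 𝕜 m n ξ k • v ∈ T) :
    ∃ S : Submodule (H 𝕜 m n ξ) V, S.restrictScalars 𝕜 = T := by
  refine ⟨{ T with smul_mem' := fun x v hv => ?_ }, rfl⟩
  have hx : x ∈ Algebra.adjoin 𝕜 (Set.range (gen 𝕜 m n ξ)) := by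
    rw [adjoin_range_gen]; trivial
  change v ∈ T at hv
  change x • v ∈ T
  induction hx using Algebra.adjoin_induction generalizing v with
  | mem g hg => obtain ⟨k, rfl⟩ := hg; exact hT k v hv
  | algebraMap r => rw [algebraMap_smul]; exact T.smul_mem r hv
  | add g h _ _ ihg ihh => rw [add_smul]; exact T.add_mem (ihg v hv) (ihh v hv)
  | mul g h _ _ ihg ihh => rw [mul_smul]; exact ihg _ (ihh v hv)

variable {𝕜 m n ξ} in
theorem IsMact.exists_submodule {l : ℕ} {i : ℤ} {mv : Fin l → V}
    (h : IsMact 𝕜 m n ξ l i mv) : ∃ S : Submodule (H 𝕜 m n ξ) V,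
      S.restrictScalars 𝕜 = Submodule.span 𝕜 (Set.range mv) := by
  refine exists_submodule_of_gen_smul_mem 𝕜 m n ξ _ fun k v hv => ?_
  induction hv using Submodule.span_induction with
  | mem v hv => obtain ⟨j, rfl⟩ := hv; exact h.gen_smul_mem k j
  | zero => rw [smul_zero]; exact zero_mem _
  | add v w _ _ hv hw => rw [smul_add]; exact add_mem hv hw
  | smul r v _ hv => rw [smul_comm]; exact Submodule.smul_mem _ _ hv

variable {𝕜 m n ξ} in
theorem IsMact.a_pow_smul {l : ℕ} {i : ℤ} {mv : Fin l → V} (h : IsMact 𝕜 m n ξ l i mv)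
    (p k : ℕ) (hk : k < l) :
    ha ^ p • mv ⟨k, hk⟩ = if hp : k + p < l then
      (∏ t ∈ Finset.range p, alph 𝕜 m n ξ l i (k + t + 1)) • mv ⟨k + p, hp⟩ else 0 := by
  obtain ⟨h1, h2, -⟩ := h
  induction p with
  | zero => simp [hk]
  | succ p ih =>
    rw [pow_succ', mul_smul, ih]
    rcases lt_trichotomy (k + p + 1) l with hp | hp | hp
    · rw [dif_pos (by omega), dif_pos (by omega), smul_comm, h1 _ hp, smul_smul,
        Finset.prod_range_succ]
      rfl
    · rw [dif_pos (by omega), dif_neg (by omega), smul_comm, h2 _ _ hp, smul_zero]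
    · rw [dif_neg (by omega), dif_neg (by omega), smul_zero]

theorem isSimpleModule_of_isMrep {l : ℕ} (hl : 0 < l) {i : ℤ} {mv : Fin l → V}
    (h : IsMrep 𝕜 m n ξ l i mv) (hα : ∀ k, 0 < k → k < l → alph 𝕜 m n ξ l i k ≠ 0) :
    IsSimpleModule (H 𝕜 m n ξ) V := by
  obtain ⟨hli, hsp, hact⟩ := h
  have hact : IsMact 𝕜 m n ξ l i mv := hact
  classical
  rw [isSimpleModule_iff_toSpanSingleton_surjective]
  refine ⟨⟨⟨0, mv ⟨0, hl⟩, (hli.ne_zero _).symm⟩⟩, fun v hv => ?_⟩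
  rw [← LinearMap.range_eq_top, LinearMap.range_toSpanSingleton]
  set N := Submodule.span (H 𝕜 m n ξ) {v} with hN
  have hvN : v ∈ N := Submodule.mem_span_singleton_self v
  obtain ⟨x, hx⟩ := (Submodule.mem_span_range_iff_exists_fun 𝕜).1
    (show v ∈ Submodule.span 𝕜 (Set.range mv) by rw [hsp]; trivial)
  obtain ⟨J, hJ, hmax⟩ : ∃ J, x J ≠ 0 ∧ ∀ k, J < k → x k = 0 := by
    have hne : (Finset.univ.filter fun k => x k ≠ 0).Nonempty := by
      by_contra hempty
      rw [Finset.not_nonempty_iff_eq_empty, Finset.filter_eq_empty_iff] at hempty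
      refine hv (hx ▸ Finset.sum_eq_zero fun k hk => ?_)
      rw [not_not.1 (hempty hk), zero_smul]
    refine ⟨_, (Finset.mem_filter.1 (Finset.max'_mem _ hne)).2, fun k hk => ?_⟩
    by_contra hxk
    exact absurd (Finset.le_max' _ k (Finset.mem_filter.2 ⟨Finset.mem_univ _, hxk⟩)) (not_le.2 hk)
  have h0 : mv ⟨0, hl⟩ ∈ N := by
    have hd0 : hd ^ (J : ℕ) • v = x J • mv ⟨0, hl⟩ := by
      rw [← hx, Finset.smul_sum, Finset.sum_eq_single J]
      · rw [smul_comm, hact.d_pow_smul _ J.1 J.2, if_pos le_rfl]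
        simp
      · intro k _ hk
        rw [smul_comm, hact.d_pow_smul _ k.1 k.2]
        rcases lt_or_gt_of_ne hk with hk | hk
        · rw [if_neg (not_le.2 (Fin.lt_def.1 hk)), smul_zero]
        · rw [hmax k hk, zero_smul]
      · exact fun h => (h (Finset.mem_univ _)).elim
    have := N.smul_of_tower_mem (x J)⁻¹ (hd0 ▸ N.smul_mem (hd ^ (J : ℕ)) hvN)
    rwa [smul_smul, inv_mul_cancel₀ hJ, one_smul] at this
  have hall : ∀ (j : ℕ) (hj : j < l), mv ⟨j, hj⟩ ∈ N := by
    intro j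
    induction j with
    | zero => exact fun _ => h0
    | succ j ih =>
      intro hj
      have := N.smul_of_tower_mem (alph 𝕜 m n ξ l i (j + 1))⁻¹
        (hact.1 j hj ▸ N.smul_mem ha (ih (by omega)))
      rwa [smul_smul, inv_mul_cancel₀ (hα _ (by omega) hj), one_smul] at this
  have hle : Submodule.span 𝕜 (Set.range mv) ≤ N.restrictScalars 𝕜 :=
    Submodule.span_le.2 (by rintro _ ⟨j, rfl⟩; exact hall j.1 j.2)
  rw [hsp] at hle
  exact eq_top_iff.2 fun w _ => hle (Submodule.mem_top (x := w))

theorem structure_of_blocks [IsArtinianRing (H 𝕜 m n ξ)] {p r : ℕ} (hp : 0 < p) (hr : 0 < r)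
    {i₁ i₂ : ℤ} {e : Fin n → V} (hli : LinearIndependent 𝕜 e)
    (hsp : Submodule.span 𝕜 (Set.range e) = ⊤) (E : Fin p ⊕ Fin r ≃ Fin n)
    (hu : IsMact 𝕜 m n ξ p i₁ fun j => e (E (Sum.inl j)))
    (hw : ∀ S : Submodule (H 𝕜 m n ξ) V, (∀ j, e (E (Sum.inl j)) ∈ S) →
      IsMact 𝕜 m n ξ r i₂ fun j => (Submodule.Quotient.mk (e (E (Sum.inr j))) : V ⧸ S))
    (hα₁ : ∀ k, 0 < k → k < p → alph 𝕜 m n ξ p i₁ k ≠ 0)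
    (hα₂ : ∀ k, 0 < k → k < r → alph 𝕜 m n ξ r i₂ k ≠ 0)
    (x : H 𝕜 m n ξ) (hx : ∀ j, x • e (E (Sum.inl j)) = 0) (v : V)
    (hv : x • v ∈ Submodule.span 𝕜 (Set.range fun j => e (E (Sum.inl j)))) (hv0 : x • v ≠ 0) :
    IsType 𝕜 m n ξ V 1 1 ∧
      (∃ mv : Fin p → ↥(socle 𝕜 m n ξ V), IsMrep 𝕜 m n ξ p i₁ mv) ∧
      (∃ mv : Fin r → (V ⧸ socle 𝕜 m n ξ V), IsMrep 𝕜 m n ξ r i₂ mv) := by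
  obtain ⟨S, hS⟩ := hu.exists_submodule
  have hmemS (y : V) :
      y ∈ S ↔ y ∈ Submodule.span 𝕜 (Set.range fun j => e (E (Sum.inl j))) := by
    rw [← hS, Submodule.restrictScalars_mem]
  have huS (j) : e (E (Sum.inl j)) ∈ S := (hmemS _).2 (Submodule.subset_span ⟨j, rfl⟩)
  have hliE : LinearIndependent 𝕜 (e ∘ E) := hli.comp E E.injective
  have hspE : Submodule.span 𝕜 (Set.range (e ∘ E)) = ⊤ := by rw [E.surjective.range_comp, hsp]
  obtain ⟨hli₁, hli₂, hdisj⟩ := linearIndependent_sum.1 hliE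
  have hsub : IsMrep 𝕜 m n ξ p i₁ fun j => (⟨e (E (Sum.inl j)), huS j⟩ : S) := by
    obtain ⟨h1, h2, h3, h4, h5, h6⟩ := hu
    refine ⟨.of_comp (S.subtype.restrictScalars 𝕜) hli₁, ?_,
      fun j hj => Subtype.ext (h1 j hj), fun j hj hl => Subtype.ext (h2 j hj hl),
      fun j => Subtype.ext (h3 j), fun j => Subtype.ext (h4 j),
      fun j hj => Subtype.ext (h5 j hj), fun hl => Subtype.ext (h6 hl)⟩
    rw [eq_top_iff]
    rintro ⟨s, hs⟩ -
    obtain ⟨c, rfl⟩ := (Submodule.mem_span_range_iff_exists_fun 𝕜).1 ((hmemS s).1 hs)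
    refine (Submodule.mem_span_range_iff_exists_fun 𝕜).2 ⟨c, Subtype.ext ?_⟩
    simp
  have hquo : IsMrep 𝕜 m n ξ r i₂
      fun j => (Submodule.Quotient.mk (e (E (Sum.inr j))) : V ⧸ S) := by
    refine ⟨?_, ?_, hw S huS⟩
    · refine hli₂.map (f := S.mkQ.restrictScalars 𝕜) ?_
      rw [LinearMap.ker_restrictScalars, Submodule.ker_mkQ, hS]
      exact hdisj.symm
    · rw [eq_top_iff]
      rintro y -
      obtain ⟨y, rfl⟩ := S.mkQ_surjective y
      obtain ⟨c, rfl⟩ := (Submodule.mem_span_range_iff_exists_fun 𝕜).1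
        (show y ∈ Submodule.span 𝕜 (Set.range (e ∘ E)) by rw [hspE]; trivial)
      refine (Submodule.mem_span_range_iff_exists_fun 𝕜).2 ⟨fun j => c (Sum.inr j), ?_⟩
      have h0 : S.mkQ (∑ j, c (Sum.inl j) • e (E (Sum.inl j))) = 0 := by
        rw [Submodule.mkQ_apply, Submodule.Quotient.mk_eq_zero]
        exact Submodule.sum_mem _ fun j _ => S.smul_of_tower_mem _ (huS j)
      rw [Fintype.sum_sum_type, map_add]
      simp only [Function.comp_apply]
      rw [h0, zero_add, ← LinearMap.restrictScalars_apply 𝕜, map_sum]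
      simp
  have hsimS := isSimpleModule_of_isMrep 𝕜 m n ξ hp hsub hα₁
  have hsimQ := isSimpleModule_of_isMrep 𝕜 m n ξ hr hquo hα₂
  have hxS : ∀ s ∈ S, x • s = 0 := by
    intro s hs
    obtain ⟨c, rfl⟩ := (Submodule.mem_span_range_iff_exists_fun 𝕜).1 ((hmemS s).1 hs)
    rw [Finset.smul_sum]
    exact Finset.sum_eq_zero fun j _ => by rw [smul_comm, hx, smul_zero]
  have hN := not_isCompl_of_smul 𝕜 m n ξ S x hxS v ((hmemS _).2 hv) hv0
  refine ⟨isType_of_simple 𝕜 m n ξ S hsimS hsimQ hN, ?_⟩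
  rw [socle_eq_of_simple 𝕜 m n ξ S hsimS hsimQ hN]
  exact ⟨⟨_, hsub⟩, ⟨_, hquo⟩⟩

end Structure

section Scalars

variable {𝕜 m n ξ}

theorem qInt_mul_sub_one (q : 𝕜) (k : ℕ) : qInt 𝕜 q k * (q - 1) = q ^ k - 1 :=
  geom_sum_mul q k

theorem alph_of_ne {l : ℕ} {i : ℤ} {k : ℕ} (hk : k ≠ n) : alph 𝕜 m n ξ l i k =
    qInt 𝕜 (ξ ^ m) k * ((ξ ^ m) ^ i - (ξ ^ m) ^ (i + (l : ℤ) - (k : ℤ))) :=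
  if_neg hk

variable (hq : IsPrimitiveRoot (ξ ^ m) n) (hn : 1 < n)
include hq hn

omit hn in
theorem qInt_ne_zero {k : ℕ} (hk : 0 < k) (hkn : k < n) : qInt 𝕜 (ξ ^ m) k ≠ 0 := by
  intro h
  have := qInt_mul_sub_one (ξ ^ m) k
  rw [h, zero_mul, eq_comm, sub_eq_zero] at this
  exact hq.pow_ne_one_of_pos_of_lt hk.ne' hkn this

theorem qInt_self : qInt 𝕜 (ξ ^ m) n = 0 := hq.geom_sum_eq_zero hn

theorem alph_ne_zero {l : ℕ} (hl : l < n) (i : ℤ) (k : ℕ) (hk : 0 < k) (hkl : k < l) :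
    alph 𝕜 m n ξ l i k ≠ 0 := by
  have hq0 := hq.ne_zero (by omega)
  rw [alph_of_ne (by omega)]
  refine mul_ne_zero (qInt_ne_zero hq hk (by omega)) fun h => ?_
  rw [show i + (l : ℤ) - k = i + ((l - k : ℕ) : ℤ) by omega, zpow_add₀ hq0, zpow_natCast,
    sub_eq_zero, eq_comm, mul_eq_left₀ (zpow_ne_zero _ hq0)] at h
  exact hq.pow_ne_one_of_pos_of_lt (by omega) (by omega) h

omit hq hn in
theorem alph_zero (hn : 0 < n) (l : ℕ) (i : ℤ) : alph 𝕜 m n ξ l i 0 = 0 := by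
  rw [alph_of_ne hn.ne]; simp [qInt]

omit hq hn in
theorem alph_self {l : ℕ} (hl : l < n) (i : ℤ) : alph 𝕜 m n ξ l i l = 0 := by
  rw [alph_of_ne hl.ne]; simp

theorem qInt_mul_sub_qInt_mul (l : ℕ) (i : ℤ) (k : ℕ) :
    qInt 𝕜 (ξ ^ m) k * ((ξ ^ m) ^ i - (ξ ^ m) ^ (i + (l : ℤ) - (k : ℤ))) -
      qInt 𝕜 (ξ ^ m) (k + 1) * ((ξ ^ m) ^ i - (ξ ^ m) ^ (i + (l : ℤ) - ((k + 1 : ℕ) : ℤ))) =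
    (ξ ^ m) ^ (i + (l : ℤ) - ((k : ℤ) + 1)) - (ξ ^ m) ^ (i + (k : ℤ)) := by
  have hq0 := hq.ne_zero (by omega)
  have h1 := sub_ne_zero.2 (hq.ne_one hn)
  refine mul_right_cancel₀ h1 ?_
  rw [sub_mul, mul_right_comm, qInt_mul_sub_one, mul_right_comm, qInt_mul_sub_one,
    show i + (l : ℤ) - k = i + l - (k + 1) + 1 by ring, zpow_add_one₀ hq0, Nat.cast_add_one,
    zpow_add₀ hq0 i k, zpow_natCast _ k]
  ring

theorem alph_sub_alph (l : ℕ) (i : ℤ) (k : ℕ) (hk : k + 1 < n) :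
    alph 𝕜 m n ξ l i k - alph 𝕜 m n ξ l i (k + 1) =
      (ξ ^ m) ^ (i + (l : ℤ) - ((k : ℤ) + 1)) - (ξ ^ m) ^ (i + (k : ℤ)) := by
  rw [alph_of_ne (by omega), alph_of_ne hk.ne, qInt_mul_sub_qInt_mul hq hn]

theorem alph_pred (l : ℕ) (i : ℤ) (k : ℕ) (hk : k + 1 = n) : alph 𝕜 m n ξ l i k =
    (ξ ^ m) ^ (i + (l : ℤ) - ((k : ℤ) + 1)) - (ξ ^ m) ^ (i + (k : ℤ)) := by
  have := qInt_mul_sub_qInt_mul hq hn l i k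
  rwa [hk, qInt_self hq hn, zero_mul, sub_zero, ← alph_of_ne (n := n) (by omega)] at this

theorem zpow_add_order (j : ℤ) : (ξ ^ m) ^ (j + (n : ℤ)) = (ξ ^ m) ^ j := by
  rw [zpow_add₀ (hq.ne_zero (by omega)), zpow_natCast, hq.pow_eq_one, mul_one]

theorem alph_add {l : ℕ} (hl : l < n) (i : ℤ) (k : ℕ) (hk : l + k < n) (hl0 : 0 < l) :
    alph 𝕜 m n ξ l i (l + k) = alph 𝕜 m n ξ (n - l) (i + l) k := by
  have hq0 := hq.ne_zero (by omega)
  have h1 := sub_ne_zero.2 (hq.ne_one hn)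
  refine mul_right_cancel₀ h1 ?_
  rw [alph_of_ne hk.ne, alph_of_ne (by omega), mul_right_comm, qInt_mul_sub_one, mul_right_comm,
    qInt_mul_sub_one, Nat.cast_sub hl.le,
    show i + (l : ℤ) + ((n : ℤ) - l) - k = (i - k) + n by ring, zpow_add_order hq hn,
    show i + (l : ℤ) - ((l + k : ℕ) : ℤ) = i - k by push_cast; ring, pow_add,
    show i = (i - k) + k by ring, zpow_add₀ hq0, add_sub_cancel_right, add_assoc,
    zpow_add₀ hq0 _ ((k : ℤ) + l), zpow_add₀ hq0 (k : ℤ) l, zpow_natCast, zpow_natCast]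
  ring

end Scalars

section MatrixReps

variable {𝕜 n}

theorem matrix_pow_eq_zero (M : Matrix (Fin n) (Fin n) 𝕜) (h : Fin n → ℕ) (hh : ∀ j, h j < n)
    (hM : ∀ r c, M r c ≠ 0 → h c < h r) : M ^ n = 0 := by
  have key (k : ℕ) : ∀ r c, (M ^ k) r c ≠ 0 → h c + k ≤ h r := by
    induction k with
    | zero =>
      intro r c hrc
      rw [pow_zero] at hrc
      by_cases e : r = c
      · rw [e, add_zero]
      · exact (hrc (Matrix.one_apply_ne e)).elim
    | succ k ih =>
      intro r c hrc
      rw [pow_succ, Matrix.mul_apply] at hrc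
      obtain ⟨j, -, hj⟩ := Finset.exists_ne_zero_of_sum_ne_zero hrc
      have h1 := ih r j (left_ne_zero_of_mul hj)
      have h2 := hM j c (right_ne_zero_of_mul hj)
      omega
  ext r c
  by_contra hrc
  have := key n r c hrc
  have := hh r
  omega

variable (n) in
/-- The matrix with subdiagonal entries `f` (indexed by the row) and corner entry `g`. -/
def lowMat (f : ℕ → 𝕜) (g : 𝕜) : Matrix (Fin n) (Fin n) 𝕜 := fun r c =>
  if (r : ℕ) = (c : ℕ) + 1 then f r else if (r : ℕ) = 0 ∧ (c : ℕ) = n - 1 then g else 0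

variable (n) in
/-- The matrix with superdiagonal entries `w` (indexed by the column). -/
def upMat (w : ℕ → 𝕜) : Matrix (Fin n) (Fin n) 𝕜 := fun r c =>
  if (r : ℕ) + 1 = (c : ℕ) then w c else 0

theorem lowMat_mul_upMat (f w : ℕ → 𝕜) (g : 𝕜) (h0 : f 0 * w 0 = 0) :
    lowMat n f g * upMat n w = Matrix.diagonal fun j : Fin n => f j * w j := by
  ext ⟨r, hr⟩ ⟨c, hcn⟩
  rw [Matrix.mul_apply]
  cases c with
  | zero =>
    rw [Finset.sum_eq_zero fun k _ => by simp [upMat]]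
    by_cases h : r = 0
    · subst h; simpa using h0.symm
    · rw [Matrix.diagonal_apply_ne _ (by simpa using h)]
  | succ c =>
    rw [Finset.sum_eq_single ⟨c, by omega⟩]
    · by_cases h : r = c + 1
      · subst h; simp [lowMat, upMat]
      · rw [Matrix.diagonal_apply_ne _ (by simpa using h)]
        have : c ≠ n - 1 := by omega
        simp [lowMat, h, this]
    · intro k _ hk
      have : (k : ℕ) ≠ c := fun h => hk (Fin.ext h)
      simp [upMat, this]
    · exact fun h => (h (Finset.mem_univ _)).elim

theorem upMat_mul_lowMat (f w : ℕ → 𝕜) (g : 𝕜) (hn : w n * f n = 0) :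
    upMat n w * lowMat n f g =
      Matrix.diagonal fun j : Fin n => w ((j : ℕ) + 1) * f ((j : ℕ) + 1) := by
  ext ⟨r, hr⟩ ⟨c, hcn⟩
  rw [Matrix.mul_apply]
  by_cases hr' : r + 1 = n
  · rw [Finset.sum_eq_zero fun k _ => by simp [upMat, (show r + 1 ≠ (k : ℕ) by omega)]]
    by_cases h : r = c
    · subst h; simp [hr', hn]
    · rw [Matrix.diagonal_apply_ne _ (by simpa using h)]
  · rw [Finset.sum_eq_single ⟨r + 1, by omega⟩]
    · by_cases h : r = c
      · subst h; simp [lowMat, upMat]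
      · rw [Matrix.diagonal_apply_ne _ (by simpa using h)]
        simp [lowMat, h]
    · intro k _ hk
      have : r + 1 ≠ (k : ℕ) := fun h => hk (Fin.ext h.symm)
      simp [upMat, this]
    · exact fun h => (h (Finset.mem_univ _)).elim

theorem upMat_pow_apply (w : ℕ → 𝕜) (k : ℕ) (r c : Fin n) : (upMat n w ^ k) r c =
    if (r : ℕ) + k = c then ∏ t ∈ Finset.range k, w ((r : ℕ) + 1 + t) else 0 := by
  induction k generalizing c with
  | zero => simp [Matrix.one_apply, Fin.ext_iff]
  | succ k ih =>
    rw [pow_succ, Matrix.mul_apply]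
    by_cases h : (r : ℕ) + (k + 1) = c
    · rw [if_pos h, Finset.sum_eq_single ⟨r + k, by omega⟩, ih, if_pos rfl,
        Finset.prod_range_succ]
      · have : (r : ℕ) + k + 1 = c := by omega
        simp only [upMat, this, if_true]
        rw [show (c : ℕ) = r + 1 + k by omega]
      · intro j _ hj
        have : (r : ℕ) + k ≠ j := fun h => hj (Fin.ext h.symm)
        rw [ih, if_neg this, zero_mul]
      · exact fun h => (h (Finset.mem_univ _)).elim
    · rw [if_neg h]
      refine Finset.sum_eq_zero fun j _ => ?_
      rw [ih]
      by_cases hj : (r : ℕ) + k = j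
      · have : (j : ℕ) + 1 ≠ c := by omega
        simp [upMat, this]
      · rw [if_neg hj, zero_mul]

variable {m ξ}

theorem existsUnique_rep (hn : 1 < n) (f w β γ : ℕ → 𝕜) (g : 𝕜)
    (hnil : lowMat n f g ^ n = 0)
    (hβ : ∀ j < n, β j ^ n = 1) (hγ : ∀ j < n, γ j ^ (m * n) = 1)
    (hβs : ∀ j, j + 1 < n → β j = ξ ^ m * β (j + 1))
    (hγs : ∀ j, j + 1 < n → γ (j + 1) = ξ * γ j) (hξ : ξ ≠ 0)
    (hβg : g = 0 ∨ β (n - 1) = ξ ^ m * β 0)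
    (hf0 : f 0 * w 0 = 0) (hfn : w n * f n = 0)
    (had : ∀ j < n, f j * w j - w (j + 1) * f (j + 1) = β j - γ j ^ m)
    (hac : g * γ (n - 1) = ξ⁻¹ * (γ 0 * g) +
      (ξ⁻¹ - ξ ^ (n - 1)) / qFact 𝕜 (ξ ^ m) (n - 1) *
        ((γ 0 ^ (m + 1) - ξ ^ m * (β 0 * γ 0)) * ∏ t ∈ Finset.range (n - 1), w (1 + t))) :
    ∃! φ : H 𝕜 m n ξ →ₐ[𝕜] Matrix (Fin n) (Fin n) 𝕜,
      φ (gen 𝕜 m n ξ 0) = lowMat n f g ∧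
      φ (gen 𝕜 m n ξ 1) = Matrix.diagonal (fun j : Fin n => β j) ∧
      φ (gen 𝕜 m n ξ 2) = Matrix.diagonal (fun j : Fin n => γ j) ∧
      φ (gen 𝕜 m n ξ 3) = upMat n w := by
  have hdnil : upMat n w ^ n = 0 :=
    matrix_pow_eq_zero _ (fun j => n - 1 - (j : ℕ)) (fun j => by omega) fun r c h => by
      unfold upMat at h
      have := (ite_ne_right_iff.1 h).1
      omega
  obtain ⟨φ, hφ⟩ := exists_lift 𝕜 m n ξ
    ![lowMat n f g, Matrix.diagonal (fun j : Fin n => β j),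
      Matrix.diagonal (fun j : Fin n => γ j), upMat n w] (by
    intro u v huv
    have hgen (x : Fin 4 → Matrix (Fin n) (Fin n) 𝕜) (k : Fin 4) :
        FreeAlgebra.lift 𝕜 x (fgen 𝕜 k) = x k := FreeAlgebra.lift_ι_apply x k
    cases huv <;>
      simp only [map_mul, map_sub, map_add, map_pow, map_smul, map_one, map_zero, hgen,
        Matrix.cons_val]
    case aPow =>
      rw [hnil, Matrix.diagonal_pow, eq_comm, sub_eq_zero, ← Matrix.diagonal_one]
      congr 1
      exact funext fun j => hβ j j.2
    case bPow =>
      rw [Matrix.diagonal_pow, ← Matrix.diagonal_one]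
      congr 1
      refine funext fun j => ?_
      rw [Pi.pow_apply, mul_comm m n, pow_mul, hβ j j.2, one_pow]
    case cPow =>
      rw [Matrix.diagonal_pow, ← Matrix.diagonal_one]
      congr 1
      exact funext fun j => hγ j j.2
    case dPow => exact hdnil
    case ab =>
      ext r c
      rw [Matrix.mul_diagonal, Matrix.smul_apply, Matrix.diagonal_mul, smul_eq_mul, lowMat]
      split_ifs with h1 h2
      · rw [hβs c (by omega), h1]; ring
      · rcases hβg with rfl | h
        · simp
        · rw [h2.1, h2.2, h]; ring
      · simp
    case dc =>
      ext r c
      rw [Matrix.mul_diagonal, Matrix.smul_apply, Matrix.diagonal_mul, smul_eq_mul, upMat]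
      split_ifs with h1
      · have := hγs r (by omega)
        rw [← h1, this]; ring
      · simp
    case bc => exact (Matrix.commute_diagonal _ _).eq
    case bd =>
      ext r c
      rw [Matrix.diagonal_mul, Matrix.smul_apply, Matrix.mul_diagonal, smul_eq_mul, upMat]
      split_ifs with h1
      · have := hβs r (by omega)
        rw [← h1, this]; ring
      · simp
    case ad =>
      rw [lowMat_mul_upMat _ _ _ hf0, upMat_mul_lowMat _ _ _ hfn, Matrix.diagonal_pow,
        Matrix.diagonal_sub, Matrix.diagonal_sub]
      congr 1
      exact funext fun j => had j j.2
    case ac =>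
      rw [Matrix.diagonal_pow, Matrix.diagonal_mul_diagonal, ← Matrix.diagonal_smul,
        Matrix.diagonal_sub]
      ext r c
      rw [Matrix.mul_diagonal, Matrix.add_apply, Matrix.smul_apply, Matrix.smul_apply,
        Matrix.diagonal_mul, Matrix.diagonal_mul, upMat_pow_apply, lowMat]
      simp only [smul_eq_mul, Pi.pow_apply, Pi.smul_apply]
      by_cases h1 : (r : ℕ) = c + 1
      · rw [if_pos h1, if_neg (by omega), mul_zero, mul_zero, add_zero]
        have := hγs c (by omega)
        rw [h1, this]; field_simp
      · by_cases h2 : (r : ℕ) = 0 ∧ (c : ℕ) = n - 1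
        · rw [if_neg h1, if_pos h2, if_pos (by omega), h2.1, h2.2, hac]
        · rw [if_neg h1, if_neg h2, if_neg (by omega)]
          simp)
  refine ⟨φ, ⟨hφ 0, hφ 1, hφ 2, hφ 3⟩, fun ψ hψ => hom_ext_gen 𝕜 m n ξ fun k => ?_⟩
  rw [hφ k]
  obtain ⟨h0, h1, h2, h3⟩ := hψ
  fin_cases k
  exacts [h0, h1, h2, h3]

end MatrixReps

section Modules

variable {𝕜 m n ξ}
variable (hn : 1 < n) (hξ : ξ ≠ 0) (hq : IsPrimitiveRoot (ξ ^ m) n) {l : ℕ} (hl : 0 < l)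
  (hln : l < n) (i : ℤ)
include hn hξ hq

omit hn hξ in
theorem zpow_pow_order (j : ℤ) : ((ξ ^ m) ^ j) ^ n = 1 := by
  rw [← zpow_natCast, zpow_comm, zpow_natCast, hq.pow_eq_one, one_zpow]

omit hn hξ hq in
theorem zpow_pow_comm (j : ℤ) : (ξ ^ j) ^ m = (ξ ^ m) ^ j := by
  rw [← zpow_natCast, zpow_comm, zpow_natCast]

omit hξ in
theorem zpow_eq_of_eq_add {j k : ℤ} (h : j = k + n) : (ξ ^ m) ^ j = (ξ ^ m) ^ k := by
  rw [h, zpow_add_order hq hn]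

include hl hln in
theorem existsUnique_T1 :
    ∃! φ : H 𝕜 m n ξ →ₐ[𝕜] Matrix (Fin n) (Fin n) 𝕜,
      φ (gen 𝕜 m n ξ 0) = Zmat 𝕜 m n ξ l i ∧
      φ (gen 𝕜 m n ξ 1) =
        Matrix.diagonal (fun j : Fin n => (ξ ^ m) ^ (i + (l : ℤ) - ((j : ℕ) + 1 : ℤ))) ∧
      φ (gen 𝕜 m n ξ 2) = Matrix.diagonal (fun j : Fin n => ξ ^ (i + (j : ℕ) : ℤ)) ∧
      φ (gen 𝕜 m n ξ 3) = Dmat 𝕜 n := by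
  have hq0 : ξ ^ m ≠ 0 := pow_ne_zero _ hξ
  have hZ : Zmat 𝕜 m n ξ l i = lowMat n (alph 𝕜 m n ξ l i) (alph 𝕜 m n ξ l i n) := by
    ext r c
    unfold Zmat lowMat
    split_ifs with h1
    · rw [h1]
    all_goals rfl
  have hD : Dmat 𝕜 n = upMat n fun k => if k = n then 0 else 1 := by
    ext r c
    unfold Dmat upMat
    simp only [if_neg c.2.ne]
  rw [hZ, hD]
  refine existsUnique_rep hn _ _ (fun j => (ξ ^ m) ^ (i + (l : ℤ) - ((j : ℤ) + 1)))
    (fun j => ξ ^ (i + (j : ℤ))) _ ?_ (fun j _ => zpow_pow_order hq _) (fun j _ => ?_)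
    (fun j _ => ?_) (fun j _ => ?_) hξ (Or.inr ?_) ?_ ?_ (fun j hj => ?_) ?_
  · refine matrix_pow_eq_zero _ (fun j => if l ≤ (j : ℕ) then (j : ℕ) - l else j + n - l)
      (fun j => by split_ifs <;> omega) fun r c h => ?_
    unfold lowMat at h
    split_ifs at h with h1 h2
    · have : (r : ℕ) ≠ l := fun h' => h (by rw [h', alph_self hln])
      split_ifs <;> omega
    · split_ifs <;> omega
    · exact (h rfl).elim
  · rw [pow_mul, zpow_pow_comm, zpow_pow_order hq]
  · rw [← zpow_one_add₀ hq0]; congr 1; push_cast; ring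
  · rw [← zpow_one_add₀ hξ]; congr 1; push_cast; ring
  · rw [← zpow_one_add₀ hq0, eq_comm]
    refine zpow_eq_of_eq_add hn hq ?_
    push_cast [Nat.cast_sub hn.le]; ring
  · rw [alph_zero (by omega), zero_mul]
  · rw [if_pos rfl, zero_mul]
  · rw [if_neg hj.ne, mul_one, zpow_pow_comm]
    by_cases h : j + 1 = n
    · rw [if_pos h, zero_mul, sub_zero, alph_pred hq hn _ _ _ h]
    · rw [if_neg h, one_mul, alph_sub_alph hq hn _ _ _ (by omega)]
  · rw [Finset.prod_eq_one fun t ht => if_neg (by have := Finset.mem_range.1 ht; omega)]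
    have h1 : (ξ ^ m) ^ (i + (l : ℤ)) = ξ ^ m * (ξ ^ m) ^ (i + (l : ℤ) - 1) := by
      rw [← zpow_one_add₀ hq0]; congr 1; ring
    rw [alph, if_pos rfl, h1, ← zpow_pow_comm i, zpow_add₀ hξ, zpow_natCast]
    simp only [Nat.cast_zero, add_zero, zero_add]
    ring

include hl hln in
theorem existsUnique_T1bar :
    ∃! φ : H 𝕜 m n ξ →ₐ[𝕜] Matrix (Fin n) (Fin n) 𝕜,
      φ (gen 𝕜 m n ξ 0) = (fun r c : Fin n =>
        if (r : ℕ) = (c : ℕ) + 1 then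
          (if (r : ℕ) + l < n then alph 𝕜 m n ξ (n - l) (i + l - n) (r : ℕ)
           else if (r : ℕ) + l = n then 1
           else alph 𝕜 m n ξ l i ((r : ℕ) - (n - l)))
        else 0 : Matrix (Fin n) (Fin n) 𝕜) ∧
      φ (gen 𝕜 m n ξ 1) =
        Matrix.diagonal (fun j : Fin n => (ξ ^ m) ^ (i - ((j : ℕ) + 1 : ℤ))) ∧
      φ (gen 𝕜 m n ξ 2) =
        Matrix.diagonal (fun j : Fin n => ξ ^ (i + (l : ℤ) - (n : ℤ) + (j : ℕ))) ∧
      φ (gen 𝕜 m n ξ 3) = (fun r c : Fin n =>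
        if (r : ℕ) + 1 = (c : ℕ) ∧ (c : ℕ) ≠ n - l then 1 else 0 :
          Matrix (Fin n) (Fin n) 𝕜) := by
  have hq0 : ξ ^ m ≠ 0 := pow_ne_zero _ hξ
  set f : ℕ → 𝕜 := fun r => if r + l < n then alph 𝕜 m n ξ (n - l) (i + l - n) r
    else if r + l = n then 1 else alph 𝕜 m n ξ l i (r - (n - l)) with hf
  have hA : (fun r c : Fin n => if (r : ℕ) = (c : ℕ) + 1 then f r else 0 :
      Matrix (Fin n) (Fin n) 𝕜) = lowMat n f 0 := by
    ext r c
    simp [lowMat]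
  have hD : (fun r c : Fin n => if (r : ℕ) + 1 = (c : ℕ) ∧ (c : ℕ) ≠ n - l then 1 else 0 :
      Matrix (Fin n) (Fin n) 𝕜) = upMat n fun k => if k = n - l ∨ k = n then 0 else 1 := by
    ext r c
    have := c.2.ne
    by_cases h : (c : ℕ) = n - l <;> simp [upMat, this, h]
  have hA' := existsUnique_rep (m := m) hn f (fun k => if k = n - l ∨ k = n then 0 else 1)
    (fun j => (ξ ^ m) ^ (i - ((j : ℤ) + 1))) (fun j => ξ ^ (i + (l : ℤ) - (n : ℤ) + (j : ℤ))) 0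
    (matrix_pow_eq_zero _ (fun j => j) (fun j => j.2) fun r c h => by
      unfold lowMat at h
      split_ifs at h with h1
      · omega
      · exact (h rfl).elim
      · exact (h rfl).elim)
    (fun j _ => zpow_pow_order hq _)
    (fun j _ => by rw [pow_mul, zpow_pow_comm, zpow_pow_order hq])
    (fun j _ => by rw [← zpow_one_add₀ hq0]; congr 1; push_cast; ring)
    (fun j _ => by rw [← zpow_one_add₀ hξ]; congr 1; push_cast; ring) hξ (Or.inl rfl)
    (by simp [hf, hln, alph_zero (show 0 < n by omega)]) (by simp) (fun j hj => ?_) ?_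
  · rwa [← hA, ← hD] at hA'
  · rw [zpow_pow_comm]
    rcases lt_trichotomy (j + l) n with h | h | h
    · rw [if_neg (by omega), mul_one]
      have hx : (ξ ^ m) ^ (i - ((j : ℤ) + 1)) =
          (ξ ^ m) ^ (i + l - n + ((n - l : ℕ) : ℤ) - ((j : ℤ) + 1)) := by
        congr 1; push_cast [Nat.cast_sub hln.le]; ring
      rw [hx]
      by_cases h' : j + 1 = n - l
      · rw [if_pos (Or.inl h'), zero_mul, sub_zero, hf]
        dsimp only
        rw [if_pos h]
        have := alph_sub_alph hq hn (n - l) (i + l - n) j (by omega)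
        rwa [h', alph_self (l := n - l) (by omega), sub_zero] at this
      · rw [if_neg (by omega), one_mul, hf]
        dsimp only
        rw [if_pos h, if_pos (by omega), alph_sub_alph hq hn _ _ _ (by omega)]
    all_goals
      obtain ⟨k, rfl⟩ : ∃ k, j = n - l + k := ⟨j - (n - l), by omega⟩
      have hx : (ξ ^ m) ^ (i - (((n - l + k : ℕ) : ℤ) + 1)) =
          (ξ ^ m) ^ (i + l - ((k : ℤ) + 1)) := by
        rw [eq_comm]
        refine zpow_eq_of_eq_add hn hq ?_
        push_cast [Nat.cast_sub hln.le]; ring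
      have hy : i + l - n + ((n - l + k : ℕ) : ℤ) = i + k := by
        push_cast [Nat.cast_sub hln.le]; ring
      have hz : f (n - l + k) * (if n - l + k = n - l ∨ n - l + k = n then 0 else 1) =
          alph 𝕜 m n ξ l i k := by
        by_cases hk : k = 0
        · subst hk; simp [alph_zero (show 0 < n by omega)]
        · rw [if_neg (by omega), mul_one, hf]
          dsimp only
          rw [if_neg (by omega), if_neg (by omega), Nat.add_sub_cancel_left]
      have hw : (if n - l + k + 1 = n - l ∨ n - l + k + 1 = n then 0 else 1) *
          f (n - l + k + 1) = alph 𝕜 m n ξ l i (k + 1) := by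
        by_cases hk : k + 1 = l
        · rw [if_pos (by omega), zero_mul, hk, alph_self hln]
        · rw [if_neg (by omega), one_mul, hf]
          dsimp only
          rw [if_neg (by omega), if_neg (by omega), add_assoc, Nat.add_sub_cancel_left]
      rw [hx, hy, hz, hw, alph_sub_alph hq hn _ _ _ (by omega)]
  · have h0 : (∏ t ∈ Finset.range (n - 1),
        (if 1 + t = n - l ∨ 1 + t = n then 0 else 1 : 𝕜)) = 0 :=
      Finset.prod_eq_zero (Finset.mem_range.2 (show n - l - 1 < n - 1 by omega))
        (if_pos (by omega))
    rw [h0]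
    ring

section Structure

variable {V : Type} [AddCommGroup V] [Module 𝕜 V] [Module (H 𝕜 m n ξ) V]
  [IsScalarTower 𝕜 (H 𝕜 m n ξ) V] [IsArtinianRing (H 𝕜 m n ξ)] {e : Fin n → V}

include hl hln

omit hξ in
theorem structure_T1 (he : IsT1rep 𝕜 m n ξ l hl hln i e) :
    IsType 𝕜 m n ξ V 1 1 ∧
      (∃ mv : Fin l → ↥(socle 𝕜 m n ξ V), IsMrep 𝕜 m n ξ l i mv) ∧
      (∃ mv : Fin (n - l) → (V ⧸ socle 𝕜 m n ξ V), IsMrep 𝕜 m n ξ (n - l) (i + l) mv) := by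
  obtain ⟨hli, hsp, h1, h2, h3, h4, h5, h6⟩ := he
  have hu : IsMact 𝕜 m n ξ l i fun j : Fin l => e ⟨j, by omega⟩ := by
    refine ⟨fun j hj => h1 j (by omega), fun j hj h => ?_, fun j => h3 _, fun j => h4 _,
      fun j hj => h6 j (by omega), fun _ => h5⟩
    have h0 : alph 𝕜 m n ξ l i (j + 1) = 0 := by rw [h, alph_self hln]
    rw [h1 j (by omega), h0, zero_smul]
  have hpow (p : ℕ) (j : Fin l) := hu.d_pow_smul p j j.2
  have hlast : hd ^ l • e ⟨l, hln⟩ = e ⟨0, by omega⟩ := by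
    have h := h6 (l - 1) (by omega)
    simp only [Nat.sub_add_cancel hl] at h
    have h' := hpow (l - 1) ⟨l - 1, by omega⟩
    simp only [le_refl, if_true, Nat.sub_self] at h'
    rw [← h', ← h, smul_smul, ← pow_succ]
    congr 2
    omega
  refine structure_of_blocks 𝕜 m n ξ hl (Nat.sub_pos_of_lt hln) hli hsp
    (finSumFinEquiv.trans (finCongr (Nat.add_sub_cancel' hln.le))) hu (fun S hS => ?_)
    (fun k hk hkl => alph_ne_zero hq hn hln i k hk hkl)
    (fun k hk hkl => alph_ne_zero hq hn (by omega) _ k hk hkl) (hd ^ l) (fun j => ?_)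
    (e ⟨l, hln⟩) ?_ ?_
  · have hS' (j : ℕ) (hj : j < l) : e ⟨j, by omega⟩ ∈ S := hS ⟨j, hj⟩
    change IsMact 𝕜 m n ξ (n - l) (i + l) fun j : Fin (n - l) =>
      (Submodule.Quotient.mk (e ⟨l + j, by omega⟩) : V ⧸ S)
    refine ⟨fun j hj => ?_, fun j hj h => ?_, fun j => ?_, fun j => ?_, fun j hj => ?_,
      fun _ => ?_⟩
    · rw [← Submodule.Quotient.mk_smul, h1 (l + j) (by omega), Submodule.Quotient.mk_smul,
        ← alph_add hq hn hln i (j + 1) (by omega) hl]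
      rfl
    · rw [← Submodule.Quotient.mk_smul, Submodule.Quotient.mk_eq_zero]
      have : l + j = n - 1 := by omega
      simp only [this]
      rw [h2]
      exact S.smul_of_tower_mem _ (hS' 0 hl)
    · rw [← Submodule.Quotient.mk_smul, h3, Submodule.Quotient.mk_smul]
      congr 1
      rw [eq_comm]
      refine zpow_eq_of_eq_add hn hq ?_
      push_cast [Nat.cast_sub hln.le]; ring
    · rw [← Submodule.Quotient.mk_smul, h4, Submodule.Quotient.mk_smul]
      congr 2
      push_cast; ring
    · rw [← Submodule.Quotient.mk_smul]
      exact congrArg _ (h6 (l + j) (by omega))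
    · rw [← Submodule.Quotient.mk_smul, Submodule.Quotient.mk_eq_zero]
      have := h6 (l - 1) (by omega)
      simp only [Nat.sub_add_cancel hl] at this
      simp only [add_zero]
      rw [this]
      exact hS' (l - 1) (by omega)
  · exact (hpow l j).trans (if_neg (by omega))
  · rw [hlast]
    exact Submodule.subset_span ⟨⟨0, hl⟩, rfl⟩
  · rw [hlast]
    exact hli.ne_zero _

omit hξ in
theorem structure_T1bar (he : IsT1barrep 𝕜 m n ξ l hl hln i e) :
    IsType 𝕜 m n ξ V 1 1 ∧
      (∃ mv : Fin l → ↥(socle 𝕜 m n ξ V), IsMrep 𝕜 m n ξ l i mv) ∧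
      (∃ mv : Fin (n - l) → (V ⧸ socle 𝕜 m n ξ V),
        IsMrep 𝕜 m n ξ (n - l) (i + l - n) mv) := by
  obtain ⟨hli, hsp, h1, h2, h3, h4, h5, h6, h7, h8, h9, h10⟩ := he
  have hu : IsMact 𝕜 m n ξ l i fun j : Fin l => e ⟨n - l + j, by omega⟩ := by
    refine ⟨fun j hj => h3 j hj, fun j hj h => ?_, fun j => ?_, fun j => ?_,
      fun j hj => h10 j hj, fun _ => h9⟩
    · have : n - l + j = n - 1 := by omega
      simp only [this]
      exact h4
    · rw [h5]
      congr 1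
      rw [eq_comm]
      refine zpow_eq_of_eq_add hn hq ?_
      push_cast [Nat.cast_sub hln.le]; ring
    · rw [h6]
      congr 2
      push_cast [Nat.cast_sub hln.le]; ring
  have hpow (p : ℕ) (j : Fin l) := hu.a_pow_smul p j j.2
  have hlast : ha ^ l • e ⟨n - l - 1, by omega⟩ =
      (∏ t ∈ Finset.range (l - 1), alph 𝕜 m n ξ l i (0 + t + 1)) •
        e ⟨n - l + (l - 1), by omega⟩ := by
    have h := hpow (l - 1) ⟨0, hl⟩
    rw [dif_pos (by simp [hl])] at h
    simp only [add_zero, zero_add] at h ⊢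
    rw [← h, ← h2, smul_smul, ← pow_succ, Nat.sub_add_cancel hl]
  refine structure_of_blocks 𝕜 m n ξ hl (Nat.sub_pos_of_lt hln) hli hsp
    ((Equiv.sumComm _ _).trans (finSumFinEquiv.trans (finCongr (Nat.sub_add_cancel hln.le))))
    hu (fun S hS => ?_)
    (fun k hk hkl => alph_ne_zero hq hn hln i k hk hkl)
    (fun k hk hkl => alph_ne_zero hq hn (by omega) _ k hk hkl) (ha ^ l) (fun j => ?_)
    (e ⟨n - l - 1, by omega⟩) ?_ ?_
  · change IsMact 𝕜 m n ξ (n - l) (i + l - n) fun j : Fin (n - l) =>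
      (Submodule.Quotient.mk (e ⟨j, by omega⟩) : V ⧸ S)
    refine ⟨fun j hj => ?_, fun j hj h => ?_, fun j => ?_, fun j => ?_, fun j hj => ?_,
      fun _ => ?_⟩
    · rw [← Submodule.Quotient.mk_smul, h1 j hj, Submodule.Quotient.mk_smul]
    · rw [← Submodule.Quotient.mk_smul, Submodule.Quotient.mk_eq_zero]
      have : j = n - l - 1 := by omega
      simp only [this]
      rw [h2]
      exact hS ⟨0, hl⟩
    · rw [← Submodule.Quotient.mk_smul, h5, Submodule.Quotient.mk_smul]
      congr 2
      push_cast [Nat.cast_sub hln.le]; ring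
    · rw [← Submodule.Quotient.mk_smul, h6, Submodule.Quotient.mk_smul]
    · rw [← Submodule.Quotient.mk_smul]
      exact congrArg _ (h8 j hj)
    · rw [← Submodule.Quotient.mk_smul]
      exact congrArg _ h7
  · exact (hpow l j).trans (dif_neg (by omega))
  · rw [hlast]
    exact Submodule.smul_mem _ _ (Submodule.subset_span ⟨⟨l - 1, by omega⟩, rfl⟩)
  · rw [hlast]
    refine smul_ne_zero (Finset.prod_ne_zero_iff.2 fun t ht => ?_) (hli.ne_zero _)
    have := Finset.mem_range.1 ht
    exact alph_ne_zero hq hn hln i _ (by omega) (by omega)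

end Structure

end Modules

/-- Lemma 4.10: the algebra maps `H_{mn}(ξ) → M_n(𝕜)` defining the
modules `T_1(l,i)` and `T̄_1(l,i)`, and the structure of these `(1,1)`-type modules. -/
theorem statement17 (𝕜 : Type) [Field 𝕜] [IsAlgClosed 𝕜] (m n : ℕ) (hm : 1 < m) (hn : 1 < n)
    (ξ : 𝕜) (hξ : IsPrimitiveRoot ξ (m * n))
    (l : ℕ) (hl1 : 1 ≤ l) (hl2 : l ≤ n - 1) (i : ℤ) :
    (∃! φ : H 𝕜 m n ξ →ₐ[𝕜] Matrix (Fin n) (Fin n) 𝕜,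
      φ (gen 𝕜 m n ξ 0) = Zmat 𝕜 m n ξ l i ∧
      φ (gen 𝕜 m n ξ 1) =
        Matrix.diagonal (fun j : Fin n => (ξ ^ m) ^ (i + (l : ℤ) - ((j : ℕ) + 1 : ℤ))) ∧
      φ (gen 𝕜 m n ξ 2) = Matrix.diagonal (fun j : Fin n => ξ ^ (i + (j : ℕ) : ℤ)) ∧
      φ (gen 𝕜 m n ξ 3) = Dmat 𝕜 n) ∧
    (∀ (V : Type) [AddCommGroup V] [Module 𝕜 V] [Module (H 𝕜 m n ξ) V]
        [IsScalarTower 𝕜 (H 𝕜 m n ξ) V] (e : Fin n → V),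
      IsT1rep 𝕜 m n ξ l hl1 (by omega) i e →
        IsType 𝕜 m n ξ V 1 1 ∧
        (∃ mv : Fin l → ↥(socle 𝕜 m n ξ V), IsMrep 𝕜 m n ξ l i mv) ∧
        (∃ mv : Fin (n - l) → (V ⧸ socle 𝕜 m n ξ V), IsMrep 𝕜 m n ξ (n - l) (i + l) mv)) ∧
    (∃! φ : H 𝕜 m n ξ →ₐ[𝕜] Matrix (Fin n) (Fin n) 𝕜,
      φ (gen 𝕜 m n ξ 0) = (fun r c : Fin n =>
        if (r : ℕ) = (c : ℕ) + 1 then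
          (if (r : ℕ) + l < n then alph 𝕜 m n ξ (n - l) (i + l - n) (r : ℕ)
           else if (r : ℕ) + l = n then 1
           else alph 𝕜 m n ξ l i ((r : ℕ) - (n - l)))
        else 0 : Matrix (Fin n) (Fin n) 𝕜) ∧
      φ (gen 𝕜 m n ξ 1) =
        Matrix.diagonal (fun j : Fin n => (ξ ^ m) ^ (i - ((j : ℕ) + 1 : ℤ))) ∧
      φ (gen 𝕜 m n ξ 2) =
        Matrix.diagonal (fun j : Fin n => ξ ^ (i + (l : ℤ) - (n : ℤ) + (j : ℕ))) ∧
      φ (gen 𝕜 m n ξ 3) = (fun r c : Fin n =>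
        if (r : ℕ) + 1 = (c : ℕ) ∧ (c : ℕ) ≠ n - l then 1 else 0 :
          Matrix (Fin n) (Fin n) 𝕜)) ∧
    (∀ (V : Type) [AddCommGroup V] [Module 𝕜 V] [Module (H 𝕜 m n ξ) V]
        [IsScalarTower 𝕜 (H 𝕜 m n ξ) V] (e : Fin n → V),
      IsT1barrep 𝕜 m n ξ l hl1 (by omega) i e →
        IsType 𝕜 m n ξ V 1 1 ∧
        (∃ mv : Fin l → ↥(socle 𝕜 m n ξ V), IsMrep 𝕜 m n ξ l i mv) ∧
        (∃ mv : Fin (n - l) → (V ⧸ socle 𝕜 m n ξ V),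
          IsMrep 𝕜 m n ξ (n - l) (i + l - n) mv)) := by
  have hq : IsPrimitiveRoot (ξ ^ m) n := hξ.pow (by positivity) rfl
  have hξ0 : ξ ≠ 0 := hξ.ne_zero (by positivity)
  have := finite_H 𝕜 m n ξ (by omega) (by omega) hξ0
  have : IsArtinianRing (H 𝕜 m n ξ) := IsArtinianRing.of_finite 𝕜 _
  have hln : l < n := by omega
  exact ⟨existsUnique_T1 hn hξ0 hq hl1 hln i, fun V _ _ _ _ e he => structure_T1 hn hq hl1 hln i he,
    existsUnique_T1bar hn hξ0 hq hl1 hln i,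
    fun V _ _ _ _ e he => structure_T1bar hn hq hl1 hln i he⟩

end Radford
end
end

section
/- Let M be a finite dimensional indecomposable H_{mn}(ξ)-module of (1,1)-type. Then there exist 1 ≤ l ≤ n−1 and i ∈ ℤ such that M ≅ T_1(l,i) or M ≅ T̄_1(l,i). Moreover, T_1(l,i) is never isomorphic to T̄_1(l′,i′); T_1(l,i) ≅ T_1(l′,i′) if and only if l = l′ and i ≡ i′ (mod mn); and T̄_1(l,i) ≅ T̄_1(l′,i′) if and only if l = l′ and i ≡ i′ (mod mn). -/
noncomputable section

namespace Radford

variable (𝕜 : Type) [Field 𝕜]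

variable (m n : ℕ) (ξ : 𝕜)

local notation "fa" => fgen 𝕜 0
local notation "fb" => fgen 𝕜 1
local notation "fc" => fgen 𝕜 2
local notation "fd" => fgen 𝕜 3

local notation "ha" => gen 𝕜 m n ξ 0
local notation "hb" => gen 𝕜 m n ξ 1
local notation "hc" => gen 𝕜 m n ξ 2
local notation "hd" => gen 𝕜 m n ξ 3

section Abstract

variable {𝕜 m n ξ}

theorem qInt_succ (q : 𝕜) (k : ℕ) : qInt 𝕜 q (k + 1) = qInt 𝕜 q k + q ^ k :=
  Finset.sum_range_succ _ _

theorem qInt_succ' (q : 𝕜) (k : ℕ) : qInt 𝕜 q (k + 1) = q * qInt 𝕜 q k + 1 := by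
  simp [qInt, Finset.sum_range_succ', pow_succ', Finset.mul_sum]

theorem zpow_inj_iff (hξ : IsPrimitiveRoot ξ (m * n)) (h0 : ξ ≠ 0) (s t : ℤ) :
    ξ ^ s = ξ ^ t ↔ (m * n : ℤ) ∣ s - t := by
  have := hξ.zpow_eq_one_iff_dvd (s - t)
  rw [zpow_sub₀ h0, div_eq_one_iff_eq (zpow_ne_zero _ h0)] at this
  rw [this]; push_cast; rfl

theorem zpow_inj_of_lt (hξ : IsPrimitiveRoot ξ (m * n)) (h0 : ξ ≠ 0) {s t : ℤ}
    (h : ξ ^ s = ξ ^ t) (hst : |s - t| < m * n) : s = t := by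
  have := Int.eq_zero_of_abs_lt_dvd ((zpow_inj_iff hξ h0 s t).1 h) hst
  omega

theorem pow_zpow_eq (s : ℤ) : (ξ ^ m) ^ s = ξ ^ (m * s : ℤ) := by
  rw [zpow_mul, zpow_natCast]

theorem qpow_inj_iff (hξ : IsPrimitiveRoot ξ (m * n)) (h0 : ξ ≠ 0) (hm : m ≠ 0) (s t : ℤ) :
    (ξ ^ m) ^ s = (ξ ^ m) ^ t ↔ (n : ℤ) ∣ s - t := by
  rw [pow_zpow_eq, pow_zpow_eq, zpow_inj_iff hξ h0, ← mul_sub,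
    mul_dvd_mul_iff_left (by exact_mod_cast hm)]

theorem isPrimitiveRoot_q (hξ : IsPrimitiveRoot ξ (m * n)) (hm : 0 < m) (hn : 0 < n) :
    IsPrimitiveRoot (ξ ^ m) n :=
  hξ.pow (Nat.mul_pos hm hn) rfl

theorem qInt_ne_zero_s18 {q : 𝕜} (hq : IsPrimitiveRoot q n) {k : ℕ} (hk0 : k ≠ 0) (hk : k < n) :
    qInt 𝕜 q k ≠ 0 := by
  intro h
  have h1 := qInt_mul_sub_one q k
  rw [h, zero_mul] at h1
  exact hq.pow_ne_one_of_pos_of_lt hk0 hk (sub_eq_zero.1 h1.symm)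

theorem qInt_self_s18 {q : 𝕜} (hq : IsPrimitiveRoot q n) (hn : 1 < n) : qInt 𝕜 q n = 0 :=
  hq.geom_sum_eq_zero hn

theorem qFact_ne_zero {q : 𝕜} (hq : IsPrimitiveRoot q n) {k : ℕ} (hk : k < n) :
    qFact 𝕜 q k ≠ 0 := by
  induction k with
  | zero => exact one_ne_zero
  | succ k ih => exact mul_ne_zero (ih (by omega)) (qInt_ne_zero_s18 hq (by omega) hk)

variable {V : Type} [AddCommGroup V] [Module 𝕜 V]

/-- Vectors outside `Q` in a `g`-stable subspace `P`, for `g` of finite order, have an eigenvector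
component outside `Q`. -/
theorem exists_eigenvector {N : ℕ} (hN : 0 < N) (hξ : IsPrimitiveRoot ξ N) (g : Module.End 𝕜 V)
    (hg : g ^ N = 1) (P Q : Submodule 𝕜 V) (hP : ∀ v ∈ P, g v ∈ P) (h : ¬ P ≤ Q) :
    ∃ (s : ℤ) (y : V), y ∈ P ∧ y ∉ Q ∧ g y = ξ ^ s • y := by
  have h0 : ξ ≠ 0 := hξ.ne_zero hN.ne'
  have : NeZero N := ⟨hN.ne'⟩
  have hNk : (N : 𝕜) ≠ 0 := (hξ.neZero').out
  obtain ⟨x, hxP, hxQ⟩ := SetLike.not_le_iff_exists.1 h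
  have hgP : ∀ t : ℕ, (g ^ t) x ∈ P := by
    intro t
    induction t with
    | zero => simpa using hxP
    | succ t ih => rw [pow_succ']; exact hP _ ih
  let p : ℕ → V := fun s => ∑ t ∈ Finset.range N, (ξ⁻¹ ^ (s * t)) • (g ^ t) x
  have hpP : ∀ s, p s ∈ P := fun s => P.sum_mem fun t _ => P.smul_mem _ (hgP t)
  have hsum : ∑ s ∈ Finset.range N, p s = (N : 𝕜) • x := by
    simp only [p]
    rw [Finset.sum_comm]
    have hcoef : ∀ t ∈ Finset.range N,
        ∑ s ∈ Finset.range N, (ξ⁻¹ ^ (s * t)) • (g ^ t) x = if t = 0 then (N : 𝕜) • x else 0 := by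
      intro t ht
      rw [← Finset.sum_smul]
      split_ifs with h
      · simp [h]
      · have h1 : ξ⁻¹ ^ t ≠ 1 :=
          hξ.inv.pow_ne_one_of_pos_of_lt h (Finset.mem_range.1 ht)
        have h2 := geom_sum_mul (ξ⁻¹ ^ t) N
        rw [← pow_mul, mul_comm t N, pow_mul, hξ.inv.pow_eq_one, one_pow, sub_self] at h2
        have h3 := (mul_eq_zero.1 h2).resolve_right (sub_ne_zero.2 h1)
        simp only [← pow_mul] at h3
        simp only [mul_comm _ t, h3, zero_smul]
    rw [Finset.sum_congr rfl hcoef]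
    simp [hN]
  have hex : ∃ s, p s ∉ Q := by
    by_contra! hwc
    refine hxQ ?_
    have : (N : 𝕜) • x ∈ Q := hsum ▸ Q.sum_mem fun s _ => hwc s
    exact (Q.smul_mem_iff hNk).1 this
  obtain ⟨s, hs⟩ := hex
  refine ⟨s, p s, hpP s, hs, ?_⟩
  have key : ∀ t, g ((ξ⁻¹ ^ (s * t)) • (g ^ t) x) =
      ξ ^ s • ((ξ⁻¹ ^ (s * (t + 1))) • (g ^ (t + 1)) x) := by
    intro t
    rw [map_smul, smul_smul, pow_succ' g]
    congr 1
    rw [mul_add, mul_one, pow_add, mul_left_comm, inv_pow ξ s, mul_inv_cancel₀ (pow_ne_zero _ h0),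
      mul_one]
  rw [zpow_natCast]
  simp only [p, map_sum]
  rw [Finset.sum_congr rfl fun t _ => key t, ← Finset.smul_sum]
  congr 1
  have h1 := Finset.sum_range_succ' (fun t => (ξ⁻¹ ^ (s * t)) • (g ^ t) x) N
  rw [Finset.sum_range_succ] at h1
  have h2 : (ξ⁻¹ ^ (s * N)) • (g ^ N) x = (ξ⁻¹ ^ (s * 0)) • (g ^ 0) x := by
    rw [hg, mul_comm, pow_mul, hξ.inv.pow_eq_one]; simp
  rw [h2] at h1
  exact (add_right_cancel h1).symm

theorem eq_zero_of_mem_span_eigenvectors {ι : Type} [DecidableEq ι] (g : Module.End 𝕜 V)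
    (u : ι → V) (w : ι → 𝕜)
    (K : Finset ι) (hu : ∀ k ∈ K, g (u k) = w k • u k) (y : V) (δ : 𝕜) (hy : g y = δ • y)
    (hδ : ∀ k ∈ K, δ ≠ w k) (hyK : y ∈ Submodule.span 𝕜 (u '' K)) : y = 0 := by
  induction K using Finset.induction_on generalizing y with
  | empty => simpa using hyK
  | insert k K hk ih =>
    rw [Finset.coe_insert, Set.image_insert_eq, Submodule.mem_span_insert] at hyK
    obtain ⟨r, z, hz, rfl⟩ := hyK
    have hstab : ∀ z ∈ Submodule.span 𝕜 (u '' (K : Set ι)),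
        g z ∈ Submodule.span 𝕜 (u '' (K : Set ι)) := by
      intro z hz
      induction hz using Submodule.span_induction with
      | mem x hx =>
        obtain ⟨j, hj, rfl⟩ := hx
        rw [hu j (Finset.mem_insert_of_mem hj)]
        exact Submodule.smul_mem _ _ (Submodule.subset_span ⟨j, hj, rfl⟩)
      | zero => simp
      | add x y _ _ hx hy => rw [map_add]; exact add_mem hx hy
      | smul c x _ hx => rw [map_smul]; exact Submodule.smul_mem _ _ hx
    have h1 : (δ - w k) • (r • u k + z) = g z - w k • z := by
      rw [sub_smul, ← hy, map_add, map_smul, hu k (Finset.mem_insert_self _ _)]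
      module
    have h2 : (δ - w k) • (r • u k + z) = 0 := by
      refine ih (fun j hj => hu j (Finset.mem_insert_of_mem hj)) _ ?_
        (fun j hj => hδ j (Finset.mem_insert_of_mem hj)) ?_
      · rw [map_smul, hy, smul_comm]
      · rw [h1]
        exact sub_mem (hstab z hz) (Submodule.smul_mem _ _ hz)
    exact (smul_eq_zero.1 h2).resolve_left (sub_ne_zero.2 (hδ k (Finset.mem_insert_self _ _)))

/-- An eigenvector in the span of eigenvectors with distinct eigenvalues is proportional to one
of them. -/
theorem exists_smul_eq_of_mem_span_eigenvectors {ι : Type} [DecidableEq ι] (g : Module.End 𝕜 V)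
    (u : ι → V) (w : ι → 𝕜)
    (K : Finset ι) (hu : ∀ k ∈ K, g (u k) = w k • u k) (hw : Set.InjOn w K)
    (y : V) (δ : 𝕜) (hy : g y = δ • y) (hy0 : y ≠ 0)
    (hyK : y ∈ Submodule.span 𝕜 (u '' K)) : ∃ k ∈ K, ∃ r : 𝕜, y = r • u k := by
  have hex : ∃ k ∈ K, δ = w k := by
    by_contra! hwc
    exact hy0 (eq_zero_of_mem_span_eigenvectors g u w K hu y δ hy hwc hyK)
  obtain ⟨k, hk, hδ⟩ := hex
  refine ⟨k, hk, ?_⟩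
  rw [← Finset.insert_erase hk, Finset.coe_insert, Set.image_insert_eq,
    Submodule.mem_span_insert] at hyK
  obtain ⟨r, z, hz, h⟩ := hyK
  refine ⟨r, ?_⟩
  have hz0 : z = 0 := by
    have hzy : z = y - r • u k := by rw [h]; abel
    refine eq_zero_of_mem_span_eigenvectors g u w (K.erase k)
      (fun j hj => hu j (Finset.mem_of_mem_erase hj)) z δ ?_ ?_ hz
    · rw [hzy, map_sub, hy, map_smul, hu k hk, hδ]; module
    · intro j hj hδj
      exact Finset.ne_of_mem_erase hj
        (hw (Finset.mem_of_mem_erase hj) hk (hδj.symm.trans hδ))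
  rw [h, hz0, add_zero]

variable (m n ξ) in
/-- Endomorphisms `a, b, c, d` satisfying the defining relations of `H_{mn}(ξ)`. -/
structure Rels (a b c d : Module.End 𝕜 V) : Prop where
  aPow : a ^ n = b ^ n - 1
  bPow : b ^ (m * n) = 1
  cPow : c ^ (m * n) = 1
  dPow : d ^ n = 0
  ab : a * b = ξ ^ m • (b * a)
  dc : d * c = ξ • (c * d)
  bc : b * c = c * b
  bd : b * d = ξ ^ m • (d * b)
  ad : a * d - d * a = b - c ^ m
  ac : a * c = ξ⁻¹ • (c * a) +
    ((ξ⁻¹ - ξ ^ (n - 1)) / qFact 𝕜 (ξ ^ m) (n - 1)) •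
      ((c ^ (m + 1) - ξ ^ m • (b * c)) * d ^ (n - 1))

variable (ξ) in
/-- `x` has `b`-eigenvalue `ξ ^ j` and `c`-eigenvalue `ξ ^ i`. -/
def IsWt (b c : Module.End 𝕜 V) (j i : ℤ) (x : V) : Prop := b x = ξ ^ j • x ∧ c x = ξ ^ i • x

variable (m ξ) in
/-- The scalars with `d (a ^ k x) = vcoef k • a ^ (k - 1) x` for a vector `x` of weight `(j, i)`
killed by `d`. -/
def vcoef (j i : ℤ) (k : ℕ) : 𝕜 := qInt 𝕜 (ξ ^ m) k * (ξ ^ (m * i) - ξ ^ (j + m - m * k))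

theorem vcoef_zero (j i : ℤ) : vcoef m ξ j i 0 = 0 := by simp [vcoef, qInt]

theorem vcoef_succ (h0 : ξ ≠ 0) (j i : ℤ) (k : ℕ) :
    vcoef m ξ j i (k + 1) = vcoef m ξ j i k + (ξ ^ (m * (i + k)) - ξ ^ (j - m * k)) := by
  have h1 : ξ ^ (m * (i + k)) = ξ ^ (m * i) * (ξ ^ m) ^ k := by
    rw [mul_add, zpow_add₀ h0, ← pow_mul]; norm_cast
  have h2 : ξ ^ (j + m - m * k) = ξ ^ (j - m * k) * ξ ^ m := by
    rw [← zpow_natCast ξ m, ← zpow_add₀ h0]; ring_nf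
  have h3 : ξ ^ (j + m - m * (k + 1 : ℕ)) = ξ ^ (j - m * k) := by
    push_cast; ring_nf
  have h4 := (qInt_succ (ξ ^ m) k).symm.trans (qInt_succ' (ξ ^ m) k)
  unfold vcoef
  rw [h3, h1, h2, qInt_succ]
  linear_combination (-ξ ^ (j - m * k)) * h4

theorem vcoef_eq_zero_iff (hξ : IsPrimitiveRoot ξ (m * n)) (h0 : ξ ≠ 0) (hm : 0 < m) (j i : ℤ)
    {k : ℕ} (hk0 : k ≠ 0) (hk : k < n) :
    vcoef m ξ j i k = 0 ↔ ξ ^ j = ξ ^ (m * (i + k - 1)) := by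
  have hq := qInt_ne_zero_s18 (isPrimitiveRoot_q hξ hm (by omega)) hk0 hk
  have h1 : ξ ^ (j + m - m * k) = ξ ^ (m * i) * (ξ ^ j * ξ ^ (-(m * (i + k - 1)) : ℤ)) := by
    rw [← zpow_add₀ h0, ← zpow_add₀ h0]; ring_nf
  have h2 : ξ ^ (m * i) ≠ 0 := zpow_ne_zero _ h0
  unfold vcoef
  rw [mul_eq_zero, or_iff_right hq, h1, sub_eq_zero, eq_comm, mul_eq_left₀ h2, zpow_neg,
    mul_inv_eq_one₀ (zpow_ne_zero _ h0)]

theorem vcoef_zero_unique (hξ : IsPrimitiveRoot ξ (m * n)) (h0 : ξ ≠ 0) (hm : 0 < m) (j i : ℤ)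
    {k k' : ℕ} (hk0 : k ≠ 0) (hk : k < n) (hk0' : k' ≠ 0) (hk' : k' < n)
    (h : vcoef m ξ j i k = 0) (h' : vcoef m ξ j i k' = 0) : k = k' := by
  rw [vcoef_eq_zero_iff hξ h0 hm j i hk0 hk] at h
  rw [vcoef_eq_zero_iff hξ h0 hm j i hk0' hk', h, ← pow_zpow_eq, ← pow_zpow_eq,
    qpow_inj_iff hξ h0 hm.ne'] at h'
  have := Int.eq_zero_of_abs_lt_dvd h' (by rw [abs_lt]; constructor <;> omega)
  omega

theorem alph_eq_vcoef (l : ℕ) (i j : ℤ) (h0 : ξ ≠ 0) (hj : ξ ^ j = ξ ^ (m * (i + l - 1)))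
    {k : ℕ} (hk : k < n) :
    alph 𝕜 m n ξ l i k = vcoef m ξ j i k := by
  unfold alph vcoef
  rw [if_neg hk.ne, pow_zpow_eq, pow_zpow_eq]
  congr 2
  rw [show j + m - m * k = j + (m - m * k) by ring, zpow_add₀ h0, hj, ← zpow_add₀ h0]
  ring_nf

variable {a b c d : Module.End 𝕜 V}

namespace Rels

theorem d_wt (R : Rels m n ξ a b c d) (h0 : ξ ≠ 0) {j i : ℤ} {x : V} (hx : IsWt ξ b c j i x) :
    IsWt ξ b c (j + m) (i - 1) (d x) := by
  constructor
  · have := LinearMap.congr_fun R.bd x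
    simp only [Module.End.mul_apply, LinearMap.smul_apply, hx.1, map_smul, smul_smul] at this
    rw [this, ← zpow_natCast, ← zpow_add₀ h0, add_comm]
  · have := LinearMap.congr_fun R.dc x
    simp only [Module.End.mul_apply, LinearMap.smul_apply, hx.2, map_smul] at this
    rw [sub_eq_neg_add, zpow_add₀ h0, mul_smul, this, smul_smul, zpow_neg_one, inv_mul_cancel₀ h0,
      one_smul]

theorem b_a (R : Rels m n ξ a b c d) (h0 : ξ ≠ 0) {j i : ℤ} {x : V} (hx : IsWt ξ b c j i x) :
    b (a x) = ξ ^ (j - m) • a x := by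
  have := LinearMap.congr_fun R.ab x
  simp only [Module.End.mul_apply, LinearMap.smul_apply, hx.1, map_smul] at this
  rw [sub_eq_neg_add, zpow_add₀ h0, mul_smul, this, smul_smul, zpow_neg, zpow_natCast,
    inv_mul_cancel₀ (pow_ne_zero _ h0), one_smul]

theorem a_wt (R : Rels m n ξ a b c d) (h0 : ξ ≠ 0) {j i : ℤ} {x : V} (hx : IsWt ξ b c j i x)
    (hwd : (d ^ (n - 1)) x = 0) : IsWt ξ b c (j - m) (i + 1) (a x) := by
  refine ⟨R.b_a h0 hx, ?_⟩
  have := LinearMap.congr_fun R.ac x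
  simp only [Module.End.mul_apply, LinearMap.smul_apply, LinearMap.add_apply, hx.2, map_smul,
    hwd, map_zero, smul_zero, add_zero] at this
  rw [add_comm, zpow_add₀ h0, mul_smul, this, smul_smul, zpow_one, mul_inv_cancel₀ h0, one_smul]

theorem c_pow_apply {i : ℤ} {x : V} (hx : c x = ξ ^ i • x) (k : ℕ) :
    (c ^ k) x = ξ ^ (k * i) • x := by
  induction k with
  | zero => simp
  | succ k ih =>
    by_cases h0 : ξ = 0
    · rw [pow_succ, Module.End.mul_apply, hx, map_smul, ih, smul_smul]
      congr 1
      subst h0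
      rcases eq_or_ne i 0 with rfl | hi
      · simp
      · rw [zero_zpow _ hi, zero_mul, zero_zpow]
        exact mul_ne_zero (by exact_mod_cast k.succ_ne_zero) hi
    · rw [pow_succ, Module.End.mul_apply, hx, map_smul, ih, smul_smul, ← zpow_add₀ h0]
      push_cast
      ring_nf

theorem d_a (R : Rels m n ξ a b c d) {j i : ℤ} {x : V} (hx : IsWt ξ b c j i x) :
    d (a x) = a (d x) + (ξ ^ (m * i) - ξ ^ j) • x := by
  have := LinearMap.congr_fun R.ad x
  simp only [Module.End.mul_apply, LinearMap.sub_apply, hx.1, c_pow_apply hx.2] at this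
  rw [sub_smul, ← neg_sub (ξ ^ j • x), ← this]
  abel

/-- The action on the vectors `a ^ k x` generated by a vector killed by `d`. -/
theorem verma (R : Rels m n ξ a b c d) (h0 : ξ ≠ 0) {j i : ℤ} {x : V} (hx : IsWt ξ b c j i x)
    (hwd : d x = 0) {k : ℕ} (hk : k < n) :
    IsWt ξ b c (j - m * k) (i + k) ((a ^ k) x) ∧
      d ((a ^ k) x) = vcoef m ξ j i k • (a ^ (k - 1)) x ∧ (d ^ (k + 1)) ((a ^ k) x) = 0 := by
  induction k with
  | zero => simpa [vcoef_zero, hwd] using hx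
  | succ k ih =>
    obtain ⟨h1, h2, h3⟩ := ih (by omega)
    have hw : d ((a ^ (k + 1)) x) = vcoef m ξ j i (k + 1) • (a ^ k) x := by
      rw [pow_succ', Module.End.mul_apply, R.d_a h1, h2, vcoef_succ h0, add_smul, map_smul]
      congr 1
      rcases k with _ | k
      · simp [vcoef_zero]
      · rw [Nat.add_sub_cancel, pow_succ' a k, Module.End.mul_apply]
    refine ⟨?_, hw, ?_⟩
    · have hz : (d ^ (n - 1)) ((a ^ k) x) = 0 := by
        rw [show n - 1 = (n - 1 - (k + 1)) + (k + 1) by omega, pow_add, Module.End.mul_apply, h3,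
          map_zero]
      have := R.a_wt h0 h1 hz
      rw [pow_succ', Module.End.mul_apply]
      push_cast
      convert this using 1 <;> ring
    · rw [pow_succ, Module.End.mul_apply, hw, map_smul, h3, smul_zero]

end Rels

variable (a b c d) in
/-- `P` is stable under `a, b, c, d`. -/
def IsStable (P : Submodule 𝕜 V) : Prop :=
  ∀ x ∈ P, a x ∈ P ∧ b x ∈ P ∧ c x ∈ P ∧ d x ∈ P

namespace Rels

theorem isStable_span (R : Rels m n ξ a b c d) (h0 : ξ ≠ 0) {j i : ℤ} {x : V}
    (hx : IsWt ξ b c j i x) (hwd : d x = 0) {k₀ : ℕ}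
    (hv : vcoef m ξ j i k₀ = 0) (hk : k₀ = 0 ∨ ξ ^ (n * j : ℤ) = 1) :
    IsStable a b c d
      (Submodule.span 𝕜 ((fun k => (a ^ k) x) '' (Finset.Ico k₀ n : Finset ℕ))) := by
  set P := Submodule.span 𝕜 ((fun k => (a ^ k) x) '' (Finset.Ico k₀ n : Finset ℕ)) with hP
  have hmem : ∀ k, k₀ ≤ k → k < n → (a ^ k) x ∈ P := fun k h1 h2 =>
    Submodule.subset_span ⟨k, by simp [h1, h2], rfl⟩
  intro y hy
  induction hy using Submodule.span_induction with
  | mem y hy =>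
    obtain ⟨k, hk', rfl⟩ := hy
    simp only [Finset.coe_Ico, Set.mem_Ico] at hk'
    obtain ⟨h1, h2, h3⟩ := R.verma h0 hx hwd hk'.2
    simp only
    refine ⟨?_, ?_, ?_, ?_⟩
    · rw [← Module.End.mul_apply, ← pow_succ']
      rcases lt_or_eq_of_le (Nat.succ_le_of_lt hk'.2) with h | h
      · exact hmem _ (by omega) h
      · rw [← Nat.succ_eq_add_one, h, R.aPow, LinearMap.sub_apply, c_pow_apply hx.1]
        rcases hk with rfl | hk
        · have := hmem 0 le_rfl (by omega)
          simp only [pow_zero, Module.End.one_apply] at this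
          exact P.sub_mem (P.smul_mem _ this) this
        · rw [hk]; simp
    · rw [h1.1]; exact P.smul_mem _ (hmem _ hk'.1 hk'.2)
    · rw [h1.2]; exact P.smul_mem _ (hmem _ hk'.1 hk'.2)
    · rw [h2]
      rcases eq_or_lt_of_le hk'.1 with h | h
      · rw [← h, hv, zero_smul]; exact P.zero_mem
      · exact P.smul_mem _ (hmem _ (by omega) (by omega))
  | zero => simp
  | add y z _ _ hy hz =>
    simp only [map_add]
    exact ⟨P.add_mem hy.1 hz.1, P.add_mem hy.2.1 hz.2.1, P.add_mem hy.2.2.1 hz.2.2.1,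
      P.add_mem hy.2.2.2 hz.2.2.2⟩
  | smul r y _ hy =>
    simp only [map_smul]
    exact ⟨P.smul_mem _ hy.1, P.smul_mem _ hy.2.1, P.smul_mem _ hy.2.2.1,
      P.smul_mem _ hy.2.2.2⟩

/-- A weight vector in the subspace generated by `x` is proportional to some `a ^ k x`. -/
theorem exists_smul_pow (R : Rels m n ξ a b c d) (hξ : IsPrimitiveRoot ξ (m * n)) (h0 : ξ ≠ 0)
    (hm : 0 < m) {j i : ℤ} {x : V}
    (hx : IsWt ξ b c j i x) (hwd : d x = 0) {k₀ : ℕ} {j' i' : ℤ} {y : V}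
    (hy : IsWt ξ b c j' i' y) (hy0 : y ≠ 0)
    (hyP : y ∈ Submodule.span 𝕜 ((fun k => (a ^ k) x) '' (Finset.Ico k₀ n : Finset ℕ))) :
    ∃ k, k₀ ≤ k ∧ k < n ∧ ∃ r : 𝕜, y = r • (a ^ k) x := by
  have hinj : Set.InjOn (fun k : ℕ => ξ ^ (i + k)) (Finset.Ico k₀ n : Finset ℕ) := by
    intro k hk k' hk' h
    simp only [Finset.coe_Ico, Set.mem_Ico] at hk hk'
    have hlt : (n : ℤ) ≤ m * n := by exact_mod_cast Nat.le_mul_of_pos_left n hm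
    have := zpow_inj_of_lt hξ h0 h (by rw [abs_lt]; constructor <;> omega)
    omega
  obtain ⟨k, hk, r, hr⟩ := exists_smul_eq_of_mem_span_eigenvectors c (fun k : ℕ => (a ^ k) x)
    (fun k => ξ ^ (i + (k : ℤ))) (Finset.Ico k₀ n)
    (fun k hk => (R.verma h0 hx hwd (Finset.mem_Ico.1 hk).2).1.2) hinj y _ hy.2 hy0 hyP
  exact ⟨k, (Finset.mem_Ico.1 hk).1, (Finset.mem_Ico.1 hk).2, r, hr⟩

theorem exists_wt (R : Rels m n ξ a b c d) (hξ : IsPrimitiveRoot ξ (m * n)) (hN : 0 < m * n)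
    (P Q : Submodule 𝕜 V) (hwb : ∀ v ∈ P, b v ∈ P) (hwc : ∀ v ∈ P, c v ∈ P) (h : ¬ P ≤ Q) :
    ∃ (j i : ℤ) (y : V), y ∈ P ∧ y ∉ Q ∧ IsWt ξ b c j i y := by
  obtain ⟨j, y, hyP, hyQ, hy⟩ := exists_eigenvector hN hξ b R.bPow P Q hwb h
  have hst : ∀ v ∈ P ⊓ LinearMap.ker (b - ξ ^ j • (1 : Module.End 𝕜 V)),
      c v ∈ P ⊓ LinearMap.ker (b - ξ ^ j • (1 : Module.End 𝕜 V)) := by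
    rintro v ⟨hv1, hv2⟩
    refine ⟨hwc v hv1, ?_⟩
    simp only [LinearMap.mem_ker, LinearMap.sub_apply, LinearMap.smul_apply,
      Module.End.one_apply, sub_eq_zero, SetLike.mem_coe] at hv2 ⊢
    rw [← Module.End.mul_apply, R.bc, Module.End.mul_apply, hv2, map_smul]
  obtain ⟨i, z, hz, hzQ, hzc⟩ := exists_eigenvector hN hξ c R.cPow _ Q hst
    (fun hle => hyQ (hle ⟨hyP, by simp [hy]⟩))
  refine ⟨j, i, z, hz.1, hzQ, ?_, hzc⟩
  simpa [sub_eq_zero] using hz.2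

theorem exists_wt_ker (R : Rels m n ξ a b c d) (hξ : IsPrimitiveRoot ξ (m * n)) (h0 : ξ ≠ 0)
    (hN : 0 < m * n) (P Q : Submodule 𝕜 V) (hwb : ∀ v ∈ P, b v ∈ P) (hwc : ∀ v ∈ P, c v ∈ P)
    (h : ¬ P ⊓ LinearMap.ker d ≤ Q) :
    ∃ (j i : ℤ) (y : V), y ∈ P ∧ d y = 0 ∧ y ∉ Q ∧ IsWt ξ b c j i y := by
  have hb' : ∀ v ∈ P ⊓ LinearMap.ker d, b v ∈ P ⊓ LinearMap.ker d := by
    rintro v ⟨h1, h2⟩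
    refine ⟨hwb v h1, ?_⟩
    have := LinearMap.congr_fun R.bd v
    simp only [SetLike.mem_coe, LinearMap.mem_ker] at h2 ⊢
    simp only [Module.End.mul_apply, LinearMap.smul_apply, h2, map_zero] at this
    exact (smul_eq_zero.1 this.symm).resolve_left (pow_ne_zero _ h0)
  have hc' : ∀ v ∈ P ⊓ LinearMap.ker d, c v ∈ P ⊓ LinearMap.ker d := by
    rintro v ⟨h1, h2⟩
    refine ⟨hwc v h1, ?_⟩
    have := LinearMap.congr_fun R.dc v
    simp only [SetLike.mem_coe, LinearMap.mem_ker] at h2 ⊢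
    simpa [h2] using this
  obtain ⟨j, i, y, hy, hyQ, hw⟩ := R.exists_wt hξ hN (P ⊓ LinearMap.ker d) Q hb' hc' h
  exact ⟨j, i, y, hy.1, hy.2, hyQ, hw⟩

theorem exists_ker_mem (R : Rels m n ξ a b c d) (P : Submodule 𝕜 V) (hP : P ≠ ⊥)
    (hwd : ∀ v ∈ P, d v ∈ P) : ¬ P ⊓ LinearMap.ker d ≤ ⊥ := by
  intro h
  obtain ⟨x, hx, hx0⟩ := P.exists_mem_ne_zero_of_ne_bot hP
  have : ∀ k, (d ^ k) x ∈ P ∧ (d ^ k) x ≠ 0 := by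
    intro k
    induction k with
    | zero => exact ⟨hx, hx0⟩
    | succ k ih =>
      rw [pow_succ', Module.End.mul_apply]
      exact ⟨hwd _ ih.1, fun h' => ih.2 ((Submodule.mem_bot 𝕜).1 (h ⟨ih.1, h'⟩))⟩
  exact (this n).2 (by rw [R.dPow]; rfl)

end Rels

theorem linearIndependent_of_wt (hξ : IsPrimitiveRoot ξ (m * n)) (h0 : ξ ≠ 0) (hm : 0 < m)
    (g : Module.End 𝕜 V) (i : ℤ) (e : ℕ → V) (he : ∀ k < n, g (e k) = ξ ^ (i + k) • e k)
    (he0 : ∀ k < n, e k ≠ 0) : LinearIndependent 𝕜 (fun k : Fin n => e k) := by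
  refine Module.End.eigenvectors_linearIndependent' g (fun k : Fin n => ξ ^ (i + (k : ℕ))) ?_ _
    fun k => ⟨Module.End.mem_eigenspace_iff.2 (he k k.2), he0 k k.2⟩
  intro k k' h
  have hlt : (n : ℤ) ≤ m * n := by exact_mod_cast Nat.le_mul_of_pos_left n hm
  have hk := k.2
  have hk' := k'.2
  have := zpow_inj_of_lt hξ h0 h (by rw [abs_lt]; constructor <;> omega)
  exact Fin.ext (by omega)

namespace Rels

/-- A module generated by a weight vector outside a minimal stable subspace `S` and killed by `d`
is of the second kind. -/
theorem exists_basis_T1bar (R : Rels m n ξ a b c d) (hξ : IsPrimitiveRoot ξ (m * n)) (h0 : ξ ≠ 0)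
    (hm : 0 < m) (S : Submodule 𝕜 V) (hS : IsStable a b c d S) (hS0 : S ≠ ⊥)
    (hmax : ∀ P, IsStable a b c d P → ¬ P ≤ S → P = ⊤)
    {j i : ℤ} {x : V} (hx : IsWt ξ b c j i x) (hwd : d x = 0) (hxS : x ∉ S) :
    ∃ (l : ℕ) (_ : 1 ≤ l ∧ l ≤ n - 1) (i : ℤ) (e : ℕ → V),
      LinearIndependent 𝕜 (fun k : Fin n => e k) ∧
      Submodule.span 𝕜 (Set.range fun k : Fin n => e k) = ⊤ ∧
      (∀ k, k + 1 < n - l → a (e k) = alph 𝕜 m n ξ (n - l) (i + l - n) (k + 1) • e (k + 1)) ∧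
      a (e (n - l - 1)) = e (n - l) ∧
      (∀ k, k + 1 < l → a (e (n - l + k)) = alph 𝕜 m n ξ l i (k + 1) • e (n - l + k + 1)) ∧
      a (e (n - 1)) = 0 ∧
      (∀ k < n, b (e k) = (ξ ^ m) ^ (i - (k + 1 : ℤ)) • e k) ∧
      (∀ k < n, c (e k) = ξ ^ (i + l - n + k : ℤ) • e k) ∧
      d (e 0) = 0 ∧
      (∀ k, k + 1 < n - l → d (e (k + 1)) = e k) ∧
      d (e (n - l)) = 0 ∧
      (∀ k, k + 1 < l → d (e (n - l + k + 1)) = e (n - l + k)) := by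
  have hN : 0 < m * n := Nat.pos_of_ne_zero fun h => by
    rcases mul_eq_zero.1 h with h | h
    · omega
    · have := R.dPow
      rw [h, pow_zero] at this
      exact hxS (by
        have h1 : x = 0 := by simpa using LinearMap.congr_fun this x
        rw [h1]; exact S.zero_mem)
  have hn : 0 < n := Nat.pos_of_mul_pos_left hN
  have htop : Submodule.span 𝕜 ((fun k => (a ^ k) x) '' (Finset.Ico 0 n : Finset ℕ)) = ⊤ := by
    refine hmax _ (R.isStable_span h0 hx hwd (vcoef_zero j i) (Or.inl rfl)) fun h => hxS (h ?_)
    exact Submodule.subset_span ⟨0, by simpa using hn, by simp⟩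
  obtain ⟨j', i', y, hyS, hyd, hy0, hy⟩ := R.exists_wt_ker hξ h0 hN S ⊥ (fun v hv => (hS v hv).2.1)
    (fun v hv => (hS v hv).2.2.1) (R.exists_ker_mem S hS0 fun v hv => (hS v hv).2.2.2)
  rw [Submodule.mem_bot] at hy0
  obtain ⟨s, -, hsn, r, hr⟩ := R.exists_smul_pow hξ h0 hm hx hwd hy hy0 (htop ▸ Submodule.mem_top)
  have hr0 : r ≠ 0 := fun h => hy0 (by rw [hr, h, zero_smul])
  have hs0 : s ≠ 0 := by
    rintro rfl
    rw [hr, pow_zero, Module.End.one_apply] at hyS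
    exact hxS ((S.smul_mem_iff hr0).1 hyS)
  have hxs : (a ^ s) x ≠ 0 := fun h => hy0 (by rw [hr, h, smul_zero])
  have hx_le : ∀ k ≤ s, (a ^ k) x ≠ 0 := by
    intro k hk h
    apply hxs
    rw [show s = (s - k) + k by omega, pow_add, Module.End.mul_apply, h, map_zero]
  have hvs : vcoef m ξ j i s = 0 := by
    rw [hr, map_smul, (R.verma h0 hx hwd hsn).2.1, smul_smul] at hyd
    exact (mul_eq_zero.1 ((smul_eq_zero.1 hyd).resolve_right (hx_le _ (by omega)))).resolve_left hr0
  have hj := (vcoef_eq_zero_iff hξ h0 hm j i hs0 hsn).1 hvs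
  have hv : ∀ k, k ≠ 0 → k < n → k ≠ s → vcoef m ξ j i k ≠ 0 := fun k hk0 hk hks h =>
    hks (vcoef_zero_unique hξ h0 hm j i hk0 hk hs0 hsn h hvs)
  have hx_ne : ∀ k < n, (a ^ k) x ≠ 0 := by
    intro k
    induction k with
    | zero => exact fun _ => hx_le 0 (by omega)
    | succ k ih =>
      intro hk h
      by_cases hks : k + 1 ≤ s
      · exact hx_le _ hks h
      · have := (R.verma h0 hx hwd hk).2.1
        rw [h, map_zero, Nat.add_sub_cancel, eq_comm, smul_eq_zero] at this
        exact this.elim (hv _ (by omega) hk (by omega)) (ih (by omega))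
  have han : (a ^ n) x = 0 := by
    have hjn : ξ ^ (n * j : ℤ) = 1 := by
      rw [mul_comm, zpow_mul, hj, ← zpow_mul, hξ.zpow_eq_one_iff_dvd]
      exact ⟨i + s - 1, by push_cast; ring⟩
    rw [R.aPow, LinearMap.sub_apply, c_pow_apply hx.1, hjn]
    simp
  let f : ℕ → 𝕜 := fun k => ∏ t ∈ Finset.range k, if t + 1 = s then 1 else (vcoef m ξ j i (t + 1))⁻¹
  have hf1 : ∀ k, k + 1 ≠ s → k + 1 < n → f k = vcoef m ξ j i (k + 1) * f (k + 1) := by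
    intro k hk hkn
    simp only [f]
    rw [Finset.prod_range_succ, if_neg hk, mul_left_comm,
      mul_inv_cancel₀ (hv _ (by omega) hkn hk), mul_one]
  have hf2 : f (s - 1) = f s := by
    conv_rhs => rw [show s = (s - 1) + 1 by omega]
    simp only [f]
    rw [Finset.prod_range_succ, if_pos (by omega), mul_one]
  have hf0 : ∀ k < n, f k ≠ 0 := by
    intro k hk
    refine Finset.prod_ne_zero_iff.2 fun t ht => ?_
    split_ifs with h
    · exact one_ne_zero
    · exact inv_ne_zero (hv _ (by omega) (by have := Finset.mem_range.1 ht; omega) h)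
  have hae : ∀ k, k + 1 ≠ s → k + 1 < n →
      a (f k • (a ^ k) x) = vcoef m ξ j i (k + 1) • f (k + 1) • (a ^ (k + 1)) x := by
    intro k hk hkn
    rw [map_smul, pow_succ' a k, Module.End.mul_apply, smul_smul, ← hf1 k hk hkn]
  have hde : ∀ k, k + 1 ≠ s → k + 1 < n → d (f (k + 1) • (a ^ (k + 1)) x) = f k • (a ^ k) x := by
    intro k hk hkn
    rw [map_smul, (R.verma h0 hx hwd hkn).2.1, smul_smul, mul_comm, ← hf1 k hk hkn,
      Nat.add_sub_cancel]
  have hcast : ((n - s : ℕ) : ℤ) = n - s := by omega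
  have hns : n - (n - s) = s := by omega
  have hw : ∀ k < n, c (f k • (a ^ k) x) = ξ ^ (i + k) • f k • (a ^ k) x := fun k hk => by
    rw [map_smul, (R.verma h0 hx hwd hk).1.2, smul_comm]
  have hne : ∀ k < n, f k • (a ^ k) x ≠ 0 := fun k hk => smul_ne_zero (hf0 k hk) (hx_ne k hk)
  refine ⟨n - s, by omega, i + s, fun k => f k • (a ^ k) x,
    linearIndependent_of_wt hξ h0 hm c i _ hw hne, ?_, ?_, ?_, ?_, ?_, ?_, ?_, ?_, ?_, ?_, ?_⟩
  · rw [eq_top_iff, ← htop, Submodule.span_le]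
    rintro _ ⟨k, hk, rfl⟩
    simp only [Finset.coe_Ico, Set.mem_Ico] at hk
    exact (Submodule.smul_mem_iff _ (hf0 k hk.2)).1 (Submodule.subset_span ⟨⟨k, hk.2⟩, rfl⟩)
  · intro k hk
    rw [hns] at hk
    rw [hns, hcast, alph_eq_vcoef (n := n) (k := k + 1) s (i + s + (n - s) - n) j h0
        (by rw [hj]; ring_nf) (by omega),
      show i + s + (n - s) - n = i by ring]
    have hks : k + 1 ≠ s := by omega
    have hkn : k + 1 < n := by omega
    exact hae k hks hkn
  · rw [hns]
    simp only
    rw [map_smul, ← Module.End.mul_apply, ← pow_succ', hf2, show s - 1 + 1 = s by omega]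
  · intro k hk
    rw [hns]
    have hq1 : ξ ^ m - 1 ≠ 0 := sub_ne_zero.2
      ((isPrimitiveRoot_q hξ hm hn).ne_one (by omega))
    have key : alph 𝕜 m n ξ (n - s) (i + s) (k + 1) = vcoef m ξ j i (s + k + 1) := by
      rw [← alph_eq_vcoef (n := n) (k := s + k + 1) s i j h0 hj (by omega)]
      unfold alph
      rw [if_neg (by omega), if_neg (by omega)]
      apply mul_right_cancel₀ hq1
      have hq0 : ξ ^ m ≠ 0 := pow_ne_zero _ h0
      have hqn : (ξ ^ m) ^ (n : ℤ) = 1 := by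
        rw [zpow_natCast, ← pow_mul, hξ.pow_eq_one]
      have e1 := qInt_mul_sub_one (ξ ^ m) (k + 1)
      have e2 := qInt_mul_sub_one (ξ ^ m) (s + k + 1)
      have e3 : (ξ ^ m) ^ (i + s + (n - s : ℕ) - (k + 1 : ℕ)) = (ξ ^ m) ^ (i - (k + 1)) := by
        rw [hcast, show i + s + (n - s) - (k + 1 : ℕ) = i - (k + 1) + (n : ℤ) by push_cast; ring,
          zpow_add₀ hq0, hqn, mul_one]
      have e4 : (ξ ^ m) ^ (i + s - (s + k + 1 : ℕ)) = (ξ ^ m) ^ (i - (k + 1)) := by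
        congr 1; push_cast; ring
      have e5 : (ξ ^ m) ^ (i + s) = (ξ ^ m) ^ (i - (k + 1)) * (ξ ^ m) ^ (s + k + 1) := by
        rw [← zpow_natCast (ξ ^ m) (s + k + 1), ← zpow_add₀ hq0]; congr 1; push_cast; ring
      have e6 : (ξ ^ m) ^ i = (ξ ^ m) ^ (i - (k + 1)) * (ξ ^ m) ^ (k + 1) := by
        rw [← zpow_natCast (ξ ^ m) (k + 1), ← zpow_add₀ hq0]; congr 1; push_cast; ring
      rw [e3, e4, e5, e6]
      linear_combination (ξ ^ m) ^ (i - (k + 1)) *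
        (((ξ ^ m) ^ (s + k + 1) - 1) * e1 - ((ξ ^ m) ^ (k + 1) - 1) * e2)
    rw [key]
    exact hae (s + k) (by omega) (by omega)
  · simp only
    rw [map_smul, ← Module.End.mul_apply, ← pow_succ', show n - 1 + 1 = n by omega, han, smul_zero]
  · intro k hk
    rw [map_smul, (R.verma h0 hx hwd hk).1.1, smul_comm, zpow_sub₀ h0, hj, ← zpow_sub₀ h0,
      pow_zpow_eq]
    ring_nf
  · intro k hk
    simp only
    rw [hw k hk, hcast]
    ring_nf
  · simp [hwd]
  · intro k hk
    exact hde k (by omega) (by omega)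
  · simp only
    rw [hns, map_smul, (R.verma h0 hx hwd hsn).2.1, hvs, zero_smul, smul_zero]
  · intro k hk
    rw [hns]
    exact hde (s + k) (by omega) (by omega)

/-- If `ker d` lies in a simple stable subspace, then it is a line. -/
theorem exists_ker_le_span (R : Rels m n ξ a b c d) (hξ : IsPrimitiveRoot ξ (m * n)) (h0 : ξ ≠ 0)
    (hm : 0 < m) (hn : 0 < n) (S : Submodule 𝕜 V) (hS : IsStable a b c d S) (hS0 : S ≠ ⊥)
    (hmin : ∀ P, IsStable a b c d P → P ≠ ⊥ → S ≤ P) (hker : LinearMap.ker d ≤ S) :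
    ∃ v, LinearMap.ker d ≤ Submodule.span 𝕜 {v} := by
  have hN : 0 < m * n := Nat.mul_pos hm hn
  obtain ⟨j, i, v, hvS, hdv, hv0, hv⟩ := R.exists_wt_ker hξ h0 hN S ⊥ (fun v hv => (hS v hv).2.1)
    (fun v hv => (hS v hv).2.2.1) (R.exists_ker_mem S hS0 fun v hv => (hS v hv).2.2.2)
  rw [Submodule.mem_bot] at hv0
  refine ⟨v, ?_⟩
  by_contra hwc
  obtain ⟨j', i', y, -, hyd, hyv, hy⟩ := R.exists_wt_ker hξ h0 hN ⊤ (Submodule.span 𝕜 {v})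
    (fun _ _ => Submodule.mem_top) (fun _ _ => Submodule.mem_top) (by rwa [top_inf_eq])
  have hy0 : y ≠ 0 := fun h => hyv (h ▸ Submodule.zero_mem _)
  have hle : S ≤ Submodule.span 𝕜 ((fun k => (a ^ k) v) '' (Finset.Ico 0 n : Finset ℕ)) := by
    refine hmin _ (R.isStable_span h0 hv hdv (vcoef_zero j i) (Or.inl rfl)) fun h => hv0 ?_
    rw [← Submodule.mem_bot 𝕜, ← h]
    exact Submodule.subset_span ⟨0, by simpa using hn, by simp⟩
  obtain ⟨k, -, hkn, r, hr⟩ := R.exists_smul_pow hξ h0 hm hv hdv hy hy0 (hle (hker hyd))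
  have hk0 : k ≠ 0 := by
    rintro rfl
    exact hyv (Submodule.mem_span_singleton.2 ⟨r, by simp [hr]⟩)
  have hr0 : r ≠ 0 := fun h => hy0 (by rw [hr, h, zero_smul])
  have hak : (a ^ k) v ≠ 0 := fun h => hy0 (by rw [hr, h, smul_zero])
  have hak' : (a ^ (k - 1)) v ≠ 0 := fun h => hak (by
    rw [show k = k - 1 + 1 by omega, pow_succ', Module.End.mul_apply, h, map_zero])
  have hvk : vcoef m ξ j i k = 0 := by
    rw [hr, map_smul, (R.verma h0 hv hdv hkn).2.1, smul_smul] at hyd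
    exact (mul_eq_zero.1 ((smul_eq_zero.1 hyd).resolve_right hak')).resolve_left hr0
  have hjn : ξ ^ (n * j : ℤ) = 1 := by
    rw [mul_comm, zpow_mul, (vcoef_eq_zero_iff hξ h0 hm j i hk0 hkn).1 hvk, ← zpow_mul,
      hξ.zpow_eq_one_iff_dvd]
    exact ⟨i + k - 1, by push_cast; ring⟩
  have hle' := hmin _ (R.isStable_span h0 hv hdv hvk (Or.inr hjn)) fun h => hak (by
    rw [← Submodule.mem_bot 𝕜, ← h]
    exact Submodule.subset_span ⟨k, by simpa using hkn, rfl⟩)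
  obtain ⟨k', hkk', hkn', r', hr'⟩ := R.exists_smul_pow hξ h0 hm hv hdv hv hv0 (hle' hvS)
  have hw : ξ ^ (i + k') • v = ξ ^ i • v := by
    rw [← hv.2]
    conv_rhs => rw [hr', map_smul, (R.verma h0 hv hdv hkn').1.2, smul_comm, ← hr']
  have hlt : (n : ℤ) ≤ m * n := by exact_mod_cast Nat.le_mul_of_pos_left n hm
  have := zpow_inj_of_lt hξ h0 (smul_left_injective 𝕜 hv0 hw)
    (by rw [abs_lt]; constructor <;> omega)
  omega

/-- If `ker d` lies in a proper simple stable subspace contained in every nonzero stable subspace,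
then the module is of the first kind. -/
theorem exists_basis_T1 (R : Rels m n ξ a b c d) (hξ : IsPrimitiveRoot ξ (m * n)) (h0 : ξ ≠ 0)
    (hm : 1 < m) (hn : 1 < n) (S : Submodule 𝕜 V) (hS : IsStable a b c d S) (hS0 : S ≠ ⊥)
    (hS1 : S ≠ ⊤) (hmin : ∀ P, IsStable a b c d P → P ≠ ⊥ → S ≤ P) (hker : LinearMap.ker d ≤ S) :
    ∃ (l : ℕ) (_ : 1 ≤ l ∧ l ≤ n - 1) (i : ℤ) (e : ℕ → V),
      LinearIndependent 𝕜 (fun k : Fin n => e k) ∧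
      Submodule.span 𝕜 (Set.range fun k : Fin n => e k) = ⊤ ∧
      (∀ k, k + 1 < n → a (e k) = alph 𝕜 m n ξ l i (k + 1) • e (k + 1)) ∧
      a (e (n - 1)) = alph 𝕜 m n ξ l i n • e 0 ∧
      (∀ k < n, b (e k) = (ξ ^ m) ^ (i + l - (k + 1 : ℤ)) • e k) ∧
      (∀ k < n, c (e k) = ξ ^ (i + k : ℤ) • e k) ∧
      d (e 0) = 0 ∧
      (∀ k, k + 1 < n → d (e (k + 1)) = e k) := by
  classical
  have hm0 : 0 < m := by omega
  have hN0 : 0 < m * n := by positivity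
  obtain ⟨v, hv⟩ := R.exists_ker_le_span hξ h0 hm0 (by omega) S hS hS0 hmin hker
  have hex : ∃ N, d ^ N = 0 := ⟨n, R.dPow⟩
  obtain ⟨N, hdN, hNmin⟩ : ∃ N, d ^ N = 0 ∧ ∀ k < N, d ^ k ≠ 0 :=
    ⟨Nat.find hex, Nat.find_spec hex, fun k hk => Nat.find_min hex hk⟩
  have hNn : N ≤ n := by
    by_contra! h
    exact hNmin n h R.dPow
  have hNpos : 0 < N := by
    refine Nat.pos_of_ne_zero fun h => hS0 ?_
    rw [h, pow_zero] at hdN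
    rw [eq_bot_iff]
    exact fun x _ => by simpa using LinearMap.congr_fun hdN x
  obtain ⟨jw, iw, w, -, hwk, hw⟩ := R.exists_wt hξ hN0 ⊤ (LinearMap.ker (d ^ (N - 1)))
    (fun _ _ => Submodule.mem_top) (fun _ _ => Submodule.mem_top) (by
      rw [top_le_iff, LinearMap.ker_eq_top]
      exact hNmin _ (by omega))
  rw [LinearMap.mem_ker] at hwk
  obtain ⟨j, hj⟩ : ∃ j, j = jw + m * (N - 1) := ⟨_, rfl⟩
  obtain ⟨i, hi⟩ : ∃ i, i = iw - (N - 1) := ⟨_, rfl⟩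
  have hdw : ∀ k : ℕ, IsWt ξ b c (jw + m * k) (iw - k) ((d ^ k) w) := by
    intro k
    induction k with
    | zero => simpa using hw
    | succ k ih =>
      rw [pow_succ', Module.End.mul_apply]
      convert R.d_wt h0 ih using 1 <;> push_cast <;> ring
  obtain ⟨e, he⟩ : ∃ e : ℕ → V, ∀ k, e k = (d ^ (N - 1 - k)) w := ⟨_, fun _ => rfl⟩
  have hwt : ∀ k < N, IsWt ξ b c (j - m * k) (i + k) (e k) := by
    intro k hk
    rw [he]
    have hwc : ((N - 1 - k : ℕ) : ℤ) = N - 1 - k := by omega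
    convert hdw (N - 1 - k) using 1
    · rw [hwc, hj]; ring
    · rw [hwc, hi]; ring
  have hd0 : d (e 0) = 0 := by
    rw [he, ← Module.End.mul_apply, ← pow_succ', show N - 1 - 0 + 1 = N by omega, hdN]; rfl
  have hde : ∀ k, k + 1 < N → d (e (k + 1)) = e k := by
    intro k hk
    rw [he, he, ← Module.End.mul_apply, ← pow_succ', show N - 1 - (k + 1) + 1 = N - 1 - k by omega]
  have hdk : ∀ k < N, (d ^ k) (e k) = e 0 := by
    intro k hk
    rw [he, he, ← Module.End.mul_apply, ← pow_add]
    congr 2; omega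
  have hdk' : ∀ k < N, (d ^ (k + 1)) (e k) = 0 := by
    intro k hk
    rw [pow_succ', Module.End.mul_apply, hdk k hk, hd0]
  have he0 : e 0 ≠ 0 := by rw [he]; simpa using hwk
  have hene : ∀ k < N, e k ≠ 0 := fun k hk h => he0 (by rw [← hdk k hk, h, map_zero])
  have hker0 : ∀ x, d x = 0 → ∃ r : 𝕜, x = r • e 0 := by
    intro x hx
    obtain ⟨r, hr⟩ := Submodule.mem_span_singleton.1 (hv hx)
    obtain ⟨s, hs⟩ := Submodule.mem_span_singleton.1 (hv hd0)
    have hs0 : s ≠ 0 := fun h => he0 (by rw [← hs, h, zero_smul])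
    exact ⟨r * s⁻¹, by rw [← hs, smul_smul, inv_mul_cancel_right₀ hs0, hr]⟩
  have hspan : ∀ P : Submodule 𝕜 V, (∀ k < N, e k ∈ P) → P = ⊤ := by
    intro P hP
    have key : ∀ k ≤ N, ∀ x, (d ^ k) x = 0 → x ∈ P := by
      intro k
      induction k with
      | zero => intro _ x hx; rw [pow_zero, Module.End.one_apply] at hx; exact hx ▸ P.zero_mem
      | succ k ih =>
        intro hk x hx
        rw [pow_succ', Module.End.mul_apply] at hx
        obtain ⟨r, hr⟩ := hker0 _ hx
        have := ih (by omega) (x - r • e k) (by rw [map_sub, map_smul, hdk k hk, hr, sub_self])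
        exact (P.sub_mem_iff_left (P.smul_mem r (hP k hk))).1 this
    exact eq_top_iff.2 fun x _ => key N le_rfl x (by rw [hdN]; rfl)
  have hlt : (n : ℤ) < m * n := by exact_mod_cast lt_mul_left (by omega) hm
  have hda : ∀ k < N, (∀ k', k' + 1 = k → a (e k') = vcoef m ξ j i k • e k) →
      d (a (e k)) = vcoef m ξ j i (k + 1) • e k := by
    intro k hk h
    rw [R.d_a (hwt k hk), vcoef_succ h0, add_smul]
    congr 1
    rcases k with _ | k
    · rw [hd0, vcoef_zero, map_zero, zero_smul]
    · rw [hde k hk, h k rfl]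
  have hc0 : c (e 0) = ξ ^ i • e 0 := by simpa using (hwt 0 hNpos).2
  have hb0 : b (e 0) = ξ ^ j • e 0 := by simpa using (hwt 0 hNpos).1
  have hstep : ∀ k, k + 1 < N → d (a (e k)) = vcoef m ξ j i (k + 1) • e k →
      a (e k) = vcoef m ξ j i (k + 1) • e (k + 1) := by
    intro k hk h
    obtain ⟨r, hr⟩ := hker0 (a (e k) - vcoef m ξ j i (k + 1) • e (k + 1))
      (by rw [map_sub, map_smul, hde k hk, h, sub_self])
    have hz : (d ^ (n - 1)) (e k) = 0 := by
      rw [show n - 1 = (n - 1 - (k + 1)) + (k + 1) by omega, pow_add, Module.End.mul_apply,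
        hdk' k (by omega), map_zero]
    have h1 := (R.a_wt h0 (hwt k (by omega)) hz).2
    have h2 := (hwt (k + 1) hk).2
    rw [show i + (k + 1 : ℕ) = i + k + 1 by push_cast; ring] at h2
    have h3 := congrArg c hr
    rw [map_sub, map_smul, h1, h2, smul_comm _ (ξ ^ (i + k + 1)), ← smul_sub, hr, map_smul, hc0,
      smul_smul, smul_smul, mul_comm r] at h3
    rcases eq_or_ne r 0 with rfl | hr0
    · rwa [zero_smul, sub_eq_zero] at hr
    · have h4 := mul_right_cancel₀ hr0 (smul_left_injective 𝕜 he0 h3)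
      have := zpow_inj_of_lt hξ h0 h4 (by rw [abs_lt]; constructor <;> omega)
      omega
  have hae : ∀ k, k + 1 < N → a (e k) = vcoef m ξ j i (k + 1) • e (k + 1) := by
    intro k
    induction k with
    | zero => exact fun hk => hstep 0 hk (hda 0 hNpos fun k' h => by omega)
    | succ k ih =>
      refine fun hk => hstep _ hk (hda _ (by omega) fun k' h => ?_)
      obtain rfl : k' = k := by omega
      exact ih (by omega)
  have hae' : ∀ k < N, d (a (e k)) = vcoef m ξ j i (k + 1) • e k := fun k hk =>
    hda k hk fun k' hk' => by subst hk'; exact hae k' hk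
  have hexl : ∃ l, l < N ∧ e l ∉ S := by
    by_contra! h
    exact hS1 (hspan S h)
  obtain ⟨l, ⟨hlN, hlS⟩, hlmin⟩ : ∃ l, (l < N ∧ e l ∉ S) ∧ ∀ k < l, ¬ (k < N ∧ e k ∉ S) :=
    ⟨Nat.find hexl, Nat.find_spec hexl, fun k hk => Nat.find_min hexl hk⟩
  have hl0 : l ≠ 0 := by
    rintro rfl
    exact hlS (hker hd0)
  have hvl : vcoef m ξ j i l = 0 := by
    by_contra h
    have h1 : e (l - 1) ∈ S := by
      by_contra h'
      exact hlmin (l - 1) (by omega) ⟨by omega, h'⟩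
    have h2 := hae (l - 1) (by omega)
    rw [show l - 1 + 1 = l by omega] at h2
    exact hlS ((S.smul_mem_iff h).1 (h2 ▸ (hS _ h1).1))
  have hNn' : N = n := by
    by_contra hne
    have h1 := hae' (N - 1) (by omega)
    rw [show N - 1 + 1 = N by omega] at h1
    have h2 : (d ^ N) (a (e (N - 1))) = 0 := by rw [hdN]; rfl
    rw [show N = N - 1 + 1 by omega, pow_succ, Module.End.mul_apply,
      show N - 1 + 1 = N by omega, h1, map_smul, hdk _ (by omega), smul_eq_zero] at h2
    have := vcoef_zero_unique hξ h0 hm0 j i hl0 (by omega) (by omega) (by omega) hvl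
      (h2.resolve_right he0)
    omega
  subst hNn'
  have hjl := (vcoef_eq_zero_iff hξ h0 hm0 j i hl0 hlN).1 hvl
  have hq := isPrimitiveRoot_q hξ hm0 hNpos
  refine ⟨l, by omega, i, e,
    linearIndependent_of_wt hξ h0 hm0 c i e (fun k hk => (hwt k hk).2) hene,
    hspan _ fun k hk => Submodule.subset_span ⟨⟨k, hk⟩, rfl⟩, ?_, ?_, ?_,
    fun k hk => (hwt k hk).2, hd0, hde⟩
  · intro k hk
    rw [alph_eq_vcoef l i j h0 hjl hk]
    exact hae k hk
  · have h1 := hae' (N - 1) (by omega)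
    rw [show N - 1 + 1 = N by omega] at h1
    rw [show vcoef m ξ j i N = 0 by rw [vcoef, qInt_self_s18 hq hn, zero_mul], zero_smul] at h1
    obtain ⟨r, hr⟩ := hker0 _ h1
    have hac := LinearMap.congr_fun R.ac (e (N - 1))
    simp only [Module.End.mul_apply, LinearMap.smul_apply, LinearMap.add_apply,
      LinearMap.sub_apply, (hwt (N - 1) (by omega)).2, map_smul, hr, hdk (N - 1) (by omega),
      c_pow_apply hc0, hc0, hb0, smul_smul, ← sub_smul, ← add_smul] at hac
    have hsc := smul_left_injective 𝕜 he0 hac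
    rw [hr]
    congr 1
    unfold alph
    rw [if_pos rfl]
    have hF := qFact_ne_zero hq (show N - 1 < N by omega)
    have hx : ξ ^ (N - 1) - ξ⁻¹ ≠ 0 := by
      rw [sub_ne_zero, ← zpow_natCast, ← zpow_neg_one]
      intro h
      have := zpow_inj_of_lt hξ h0 h (by rw [abs_lt]; constructor <;> omega)
      omega
    have e1 : ξ ^ (i + ((N - 1 : ℕ) : ℤ)) = ξ ^ i * ξ ^ (N - 1) := by
      rw [zpow_add₀ h0, zpow_natCast]
    have e2 : ξ ^ (((m + 1 : ℕ) : ℤ) * i) = ξ ^ i * (ξ ^ m) ^ i := by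
      rw [pow_zpow_eq, ← zpow_add₀ h0]; congr 1; push_cast; ring
    have e3 : (ξ ^ m) ^ (i + l) = ξ ^ m * ξ ^ j := by
      rw [hjl, pow_zpow_eq, ← zpow_natCast ξ m, ← zpow_add₀ h0]; congr 1; ring
    simp only [e1, e2] at hsc
    rw [e3, eq_div_iff hF]
    have hξi : ξ ^ i ≠ 0 := zpow_ne_zero _ h0
    apply mul_left_cancel₀ (mul_ne_zero hξi hx)
    field_simp at hsc ⊢
    linear_combination hsc
  · intro k hk
    rw [(hwt k hk).1, zpow_sub₀ h0, hjl, ← zpow_sub₀ h0, pow_zpow_eq]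
    ring_nf

end Rels

end Abstract

section Transfer

variable {𝕜 m n ξ}

/-- The presentation of `H_{mn}(ξ)` as a quotient of the free algebra. -/
def proj : FreeAlgebra 𝕜 (Fin 4) →ₐ[𝕜] H 𝕜 m n ξ := RingQuot.mkAlgHom 𝕜 (HRel 𝕜 m n ξ)

theorem proj_surjective : Function.Surjective (proj : _ →ₐ[𝕜] H 𝕜 m n ξ) :=
  RingQuot.mkAlgHom_surjective 𝕜 (HRel 𝕜 m n ξ)

theorem proj_rel {x y : FreeAlgebra 𝕜 (Fin 4)} (h : HRel 𝕜 m n ξ x y) :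
    (proj x : H 𝕜 m n ξ) = proj y :=
  RingQuot.mkAlgHom_rel 𝕜 h

/-- A module of composition length one is simple. -/
theorem isSimpleModule_of_lengthIs {V : Type} [AddCommGroup V] [Module (H 𝕜 m n ξ) V]
    (h : lengthIs 𝕜 m n ξ V 1) : IsSimpleModule (H 𝕜 m n ξ) V := by
  obtain ⟨s, h1, h2, h3⟩ := h
  have hstep : s.head ⋖ s.last := by
    have hlast : Fin.last s.length = Fin.succ ⟨0, by omega⟩ := Fin.ext h3
    rw [RelSeries.last, hlast]
    exact s.step ⟨0, by omega⟩
  rw [h1, h2, bot_covBy_iff] at hstep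
  exact (isSimpleModule_iff _ _).2 (isSimpleOrder_iff_isAtom_top.2 hstep)

variable {V W : Type} [AddCommGroup V] [Module 𝕜 V] [Module (H 𝕜 m n ξ) V]

variable (n) in
/-- `e` is a basis of vectors with `c`-weights `i, i + 1, …` and `b`-weights
`j - 1, j - 2, …`. -/
def IsWtBasis (j i : ℤ) (e : Fin n → V) : Prop :=
  LinearIndependent 𝕜 e ∧ Submodule.span 𝕜 (Set.range e) = ⊤ ∧
  (∀ k : Fin n, gen 𝕜 m n ξ 1 • e k = ((ξ ^ m) ^ (j - ((k : ℕ) + 1 : ℤ)) : 𝕜) • e k) ∧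
  (∀ k : Fin n, gen 𝕜 m n ξ 2 • e k = (ξ ^ (i + (k : ℕ) : ℤ) : 𝕜) • e k)

theorem IsT1rep.isWtBasis {l : ℕ} {hl1 : 1 ≤ l} {hl2 : l < n} {i : ℤ} {e : Fin n → V}
    (h : IsT1rep 𝕜 m n ξ l hl1 hl2 i e) : IsWtBasis (𝕜 := 𝕜) (m := m) (ξ := ξ) n (i + l) i e :=
  ⟨h.1, h.2.1, h.2.2.2.2.1, h.2.2.2.2.2.1⟩

theorem IsT1barrep.isWtBasis {l : ℕ} {hl1 : 1 ≤ l} {hl2 : l < n} {i : ℤ} {e : Fin n → V}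
    (h : IsT1barrep 𝕜 m n ξ l hl1 hl2 i e) :
    IsWtBasis (𝕜 := 𝕜) (m := m) (ξ := ξ) n i (i + l - n) e :=
  ⟨h.1, h.2.1, h.2.2.2.2.2.2.1, h.2.2.2.2.2.2.2.1⟩

theorem IsT1rep.eq_zero_of_d {l : ℕ} {hl1 : 1 ≤ l} {hl2 : l < n} {i : ℤ} {e : Fin n → V}
    (h : IsT1rep 𝕜 m n ξ l hl1 hl2 i e) {k : Fin n} (hk : gen 𝕜 m n ξ 3 • e k = 0) :
    (k : ℕ) = 0 := by
  obtain ⟨k, hkn⟩ := k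
  rcases k with _ | k
  · rfl
  · rw [h.2.2.2.2.2.2.2] at hk
    exact (h.1.ne_zero _ hk).elim

theorem IsT1barrep.eq_of_d {l : ℕ} {hl1 : 1 ≤ l} {hl2 : l < n} {i : ℤ} {e : Fin n → V}
    (h : IsT1barrep 𝕜 m n ξ l hl1 hl2 i e) {k : Fin n} (hk : gen 𝕜 m n ξ 3 • e k = 0) :
    (k : ℕ) = 0 ∨ (k : ℕ) = n - l := by
  obtain ⟨k, hkn⟩ := k
  by_contra! hwc
  simp only at hwc
  rcases lt_or_ge k (n - l) with hlt | hge
  · obtain ⟨k, rfl⟩ : ∃ s, k = s + 1 := ⟨k - 1, by omega⟩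
    rw [h.2.2.2.2.2.2.2.2.2.1 k hlt] at hk
    exact h.1.ne_zero _ hk
  · obtain ⟨k, rfl⟩ : ∃ s, k = n - l + s + 1 := ⟨k - (n - l) - 1, by omega⟩
    rw [h.2.2.2.2.2.2.2.2.2.2.2 k (by omega)] at hk
    exact h.1.ne_zero _ hk

variable [IsScalarTower 𝕜 (H 𝕜 m n ξ) V] [AddCommGroup W] [Module 𝕜 W] [Module (H 𝕜 m n ξ) W]
  [IsScalarTower 𝕜 (H 𝕜 m n ξ) W]

variable (m n ξ V) in
/-- The action of a generator as an endomorphism. -/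
def genEnd (k : Fin 4) : Module.End 𝕜 V := Algebra.lsmul 𝕜 𝕜 V (gen 𝕜 m n ξ k)

theorem genEnd_apply (k : Fin 4) (v : V) : genEnd m n ξ V k v = gen 𝕜 m n ξ k • v := rfl

theorem rels_genEnd : Rels m n ξ (genEnd m n ξ V 0) (genEnd m n ξ V 1) (genEnd m n ξ V 2)
    (genEnd m n ξ V 3) := by
  let φ : FreeAlgebra 𝕜 (Fin 4) →ₐ[𝕜] Module.End 𝕜 V := (Algebra.lsmul 𝕜 𝕜 V).comp
    (proj : _ →ₐ[𝕜] H 𝕜 m n ξ)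
  have hφ : ∀ k, φ (fgen 𝕜 k) = genEnd m n ξ V k := fun _ => rfl
  have hrel : ∀ {x y}, HRel 𝕜 m n ξ x y → φ x = φ y := fun h =>
    congrArg (Algebra.lsmul 𝕜 𝕜 V) (proj_rel h)
  constructor
  · simpa [hφ] using hrel .aPow
  · simpa [hφ] using hrel .bPow
  · simpa [hφ] using hrel .cPow
  · simpa [hφ] using hrel .dPow
  · simpa only [map_mul, map_smul, hφ] using hrel .ab
  · simpa only [map_mul, map_smul, hφ] using hrel .dc
  · simpa only [map_mul, map_smul, hφ] using hrel .bc
  · simpa only [map_mul, map_smul, hφ] using hrel .bd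
  · simpa only [map_mul, map_sub, map_pow, hφ] using hrel .ad
  · simpa only [map_mul, map_sub, map_add, map_smul, map_pow, hφ] using hrel .ac

theorem smul_mem_of_gen_smul_mem (P : Submodule 𝕜 V)
    (hP : ∀ k, ∀ x ∈ P, gen 𝕜 m n ξ k • x ∈ P) (h : H 𝕜 m n ξ) {x : V} (hx : x ∈ P) :
    h • x ∈ P := by
  obtain ⟨f, rfl⟩ := proj_surjective h
  induction f using FreeAlgebra.induction generalizing x with
  | grade0 r => rw [AlgHom.commutes, algebraMap_smul]; exact P.smul_mem r hx
  | grade1 k => exact hP k x hx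
  | mul f g hf hg => rw [map_mul, mul_smul]; exact hf (hg hx)
  | add f g hf hg => rw [map_add, add_smul]; exact P.add_mem (hf hx) (hg hx)

theorem map_smul_of_gen (f : V →ₗ[𝕜] W)
    (hf : ∀ k v, f (gen 𝕜 m n ξ k • v) = gen 𝕜 m n ξ k • f v) (h : H 𝕜 m n ξ) (v : V) :
    f (h • v) = h • f v := by
  obtain ⟨x, rfl⟩ := proj_surjective h
  induction x using FreeAlgebra.induction generalizing v with
  | grade0 r => rw [AlgHom.commutes, algebraMap_smul, algebraMap_smul, map_smul]
  | grade1 k => exact hf k v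
  | mul x y hx hy => rw [map_mul, mul_smul, hx, hy, mul_smul]
  | add x y hx hy => rw [map_add, add_smul, map_add, hx, hy, add_smul]

theorem nonempty_linearEquiv {ι : Type} {e : ι → V} {e' : ι → W}
    (he : LinearIndependent 𝕜 e) (he1 : Submodule.span 𝕜 (Set.range e) = ⊤)
    (he' : LinearIndependent 𝕜 e') (he1' : Submodule.span 𝕜 (Set.range e') = ⊤)
    (h : ∀ k i, ∃ (t : 𝕜) (j : ι),
      gen 𝕜 m n ξ k • e i = t • e j ∧ gen 𝕜 m n ξ k • e' i = t • e' j) :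
    Nonempty (V ≃ₗ[H 𝕜 m n ξ] W) := by
  let B := Module.Basis.mk he he1.ge
  let B' := Module.Basis.mk he' he1'.ge
  let f : V ≃ₗ[𝕜] W := B.equiv B' (Equiv.refl ι)
  have hfe : ∀ i, f (e i) = e' i := fun i => by
    simpa [B, B'] using B.equiv_apply i B' (Equiv.refl ι)
  have hgen : ∀ k v, f (gen 𝕜 m n ξ k • v) = gen 𝕜 m n ξ k • f v := by
    intro k v
    have : f.toLinearMap ∘ₗ genEnd m n ξ V k = genEnd m n ξ W k ∘ₗ f.toLinearMap := by
      refine B.ext fun i => ?_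
      obtain ⟨t, j, h1, h2⟩ := h k i
      simp only [B, Module.Basis.mk_apply, LinearMap.comp_apply, LinearEquiv.coe_coe, genEnd_apply]
      rw [h1, hfe, h2, map_smul, hfe]
    exact LinearMap.congr_fun this v
  exact ⟨{ f with map_smul' := map_smul_of_gen f.toLinearMap hgen }⟩

theorem IsWtBasis.exists_of_linearEquiv (hξ : IsPrimitiveRoot ξ (m * n)) (h0 : ξ ≠ 0) (hm : 0 < m)
    {j i j' i' : ℤ} {e : Fin n → V} {e' : Fin n → W}
    (he : IsWtBasis (𝕜 := 𝕜) (m := m) (ξ := ξ) n j i e)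
    (he' : IsWtBasis (𝕜 := 𝕜) (m := m) (ξ := ξ) n j' i' e')
    (φ : V ≃ₗ[H 𝕜 m n ξ] W) (k : Fin n) (hk : gen 𝕜 m n ξ 3 • e k = 0) :
    ∃ k' : Fin n, gen 𝕜 m n ξ 3 • e' k' = 0 ∧ (m * n : ℤ) ∣ (i + (k : ℕ)) - (i' + (k' : ℕ)) ∧
      (n : ℤ) ∣ (j - (k : ℕ)) - (j' - (k' : ℕ)) := by
  have hφ : ∀ (r : 𝕜) (v : V), φ (r • v) = r • φ v := fun r v => by
    rw [← algebraMap_smul (H 𝕜 m n ξ) r v, map_smul, algebraMap_smul]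
  have hx0 : φ (e k) ≠ 0 := fun h => he.1.ne_zero k (φ.map_eq_zero_iff.1 h)
  have hxc : gen 𝕜 m n ξ 2 • φ (e k) = ξ ^ (i + (k : ℕ) : ℤ) • φ (e k) := by
    rw [← map_smul, he.2.2.2, hφ]
  have hxb : gen 𝕜 m n ξ 1 • φ (e k) = (ξ ^ m) ^ (j - ((k : ℕ) + 1 : ℤ)) • φ (e k) := by
    rw [← map_smul, he.2.2.1, hφ]
  have hxd : gen 𝕜 m n ξ 3 • φ (e k) = 0 := by rw [← map_smul, hk, map_zero]
  have hlt : (n : ℤ) ≤ m * n := by exact_mod_cast Nat.le_mul_of_pos_left n hm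
  have hinj : Set.InjOn (fun k : Fin n => ξ ^ (i' + (k : ℕ) : ℤ))
      (Finset.univ : Finset (Fin n)) := by
    intro s _ t _ h
    have hs := s.2
    have ht := t.2
    have := zpow_inj_of_lt hξ h0 h (by rw [abs_lt]; constructor <;> omega)
    exact Fin.ext (by omega)
  obtain ⟨k', -, r, hr⟩ := exists_smul_eq_of_mem_span_eigenvectors (genEnd m n ξ W 2) e'
    (fun k => ξ ^ (i' + (k : ℕ) : ℤ)) Finset.univ (fun k _ => he'.2.2.2 k) hinj
    (φ (e k)) _ hxc hx0 (by rw [Finset.coe_univ, Set.image_univ, he'.2.1]; trivial)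
  have hr0 : r ≠ 0 := fun h => hx0 (by rw [hr, h, zero_smul])
  have he0 : e' k' ≠ 0 := he'.1.ne_zero k'
  refine ⟨k', ?_, ?_, ?_⟩
  · rw [hr, smul_comm] at hxd
    exact (smul_eq_zero.1 hxd).resolve_left hr0
  · rw [hr, smul_comm, he'.2.2.2, smul_comm, smul_smul, smul_smul] at hxc
    exact (zpow_inj_iff hξ h0 _ _).1
      (mul_right_cancel₀ hr0 (smul_left_injective 𝕜 he0 hxc)).symm
  · rw [hr, smul_comm, he'.2.2.1, smul_comm, smul_smul, smul_smul] at hxb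
    have := (qpow_inj_iff hξ h0 hm.ne' _ _).1
      (mul_right_cancel₀ hr0 (smul_left_injective 𝕜 he0 hxb)).symm
    rwa [sub_sub_sub_comm, add_sub_add_right_eq_sub, ← sub_sub_sub_comm] at this

theorem alph_congr (hξ : IsPrimitiveRoot ξ (m * n)) (h0 : ξ ≠ 0) (hm : 0 < m) {i i' : ℤ}
    (h : (n : ℤ) ∣ i - i') (l k : ℕ) : alph 𝕜 m n ξ l i k = alph 𝕜 m n ξ l i' k := by
  have h1 : (ξ ^ m) ^ i = (ξ ^ m) ^ i' := (qpow_inj_iff hξ h0 hm.ne' _ _).2 h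
  have h2 : ∀ s : ℤ, (ξ ^ m) ^ (i + s) = (ξ ^ m) ^ (i' + s) := fun s =>
    (qpow_inj_iff hξ h0 hm.ne' _ _).2 (by rwa [add_sub_add_right_eq_sub])
  unfold alph
  rw [h1, h2, add_sub_assoc, add_sub_assoc, h2]

theorem IsT1rep.nonempty_linearEquiv (hξ : IsPrimitiveRoot ξ (m * n)) (h0 : ξ ≠ 0) (hm : 0 < m)
    {l : ℕ} {hl1 : 1 ≤ l} {hl2 : l < n} {i i' : ℤ} {e : Fin n → V} {e' : Fin n → W}
    (h : IsT1rep 𝕜 m n ξ l hl1 hl2 i e) (h' : IsT1rep 𝕜 m n ξ l hl1 hl2 i' e')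
    (hi : (m * n : ℤ) ∣ i - i') : Nonempty (V ≃ₗ[H 𝕜 m n ξ] W) := by
  have hin : (n : ℤ) ∣ i - i' := (dvd_mul_left _ _).trans hi
  have hα := alph_congr (l := l) hξ h0 hm hin
  obtain ⟨h1, h2, hwa, ha', hwb, hwc, hwd, hd'⟩ := h
  obtain ⟨g1, g2, ga, ga', gb, gc, gd, gd'⟩ := h'
  refine Radford.nonempty_linearEquiv h1 h2 g1 g2 fun s k => ?_
  obtain ⟨k, hk⟩ := k
  fin_cases s
  · rcases Nat.lt_or_ge (k + 1) n with hk' | hk'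
    · exact ⟨_, _, hwa k hk', by rw [hα]; exact ga k hk'⟩
    · obtain rfl : k = n - 1 := by omega
      exact ⟨_, _, ha', by rw [hα]; exact ga'⟩
  · refine ⟨_, _, hwb _, (gb _).trans ?_⟩
    congr 1
    exact ((qpow_inj_iff hξ h0 hm.ne' _ _).2 (by convert hin using 1; ring)).symm
  · refine ⟨_, _, hwc _, (gc _).trans ?_⟩
    congr 1
    exact ((zpow_inj_iff hξ h0 _ _).2 (by convert hi using 1; ring)).symm
  · rcases k with _ | k
    · exact ⟨0, ⟨0, hk⟩, by rw [zero_smul]; exact hwd, by rw [zero_smul]; exact gd⟩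
    · exact ⟨1, ⟨k, by omega⟩, by rw [one_smul]; exact hd' k hk, by rw [one_smul]; exact gd' k hk⟩

theorem IsT1barrep.nonempty_linearEquiv (hξ : IsPrimitiveRoot ξ (m * n)) (h0 : ξ ≠ 0) (hm : 0 < m)
    {l : ℕ} {hl1 : 1 ≤ l} {hl2 : l < n} {i i' : ℤ} {e : Fin n → V} {e' : Fin n → W}
    (h : IsT1barrep 𝕜 m n ξ l hl1 hl2 i e) (h' : IsT1barrep 𝕜 m n ξ l hl1 hl2 i' e')
    (hi : (m * n : ℤ) ∣ i - i') : Nonempty (V ≃ₗ[H 𝕜 m n ξ] W) := by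
  have hin : (n : ℤ) ∣ i - i' := (dvd_mul_left _ _).trans hi
  have hα := alph_congr (l := l) hξ h0 hm hin
  have hα' := alph_congr (l := n - l) hξ h0 hm
    (show (n : ℤ) ∣ (i + l - n) - (i' + l - n) by convert hin using 1; ring)
  obtain ⟨h1, h2, ha1, ha2, ha3, ha4, hwb, hwc, hd1, hd2, hd3, hd4⟩ := h
  obtain ⟨g1, g2, ga1, ga2, ga3, ga4, gb, gc, gd1, gd2, gd3, gd4⟩ := h'
  refine Radford.nonempty_linearEquiv h1 h2 g1 g2 fun s k => ?_
  obtain ⟨k, hk⟩ := k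
  fin_cases s
  · rcases lt_trichotomy (k + 1) (n - l) with hk' | hk' | hk'
    · exact ⟨_, _, ha1 k hk', by rw [hα']; exact ga1 k hk'⟩
    · obtain rfl : k = n - l - 1 := by omega
      exact ⟨1, _, by rw [one_smul]; exact ha2, by rw [one_smul]; exact ga2⟩
    · obtain ⟨s, rfl⟩ : ∃ s, k = n - l + s := ⟨k - (n - l), by omega⟩
      rcases Nat.lt_or_ge (s + 1) l with hs | hs
      · exact ⟨_, _, ha3 s hs, by rw [hα]; exact ga3 s hs⟩
      · obtain rfl : s = l - 1 := by omega
        have hnl : n - l + (l - 1) = n - 1 := by omega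
        simp only [hnl]
        exact ⟨0, ⟨0, by omega⟩, by rw [zero_smul]; exact ha4, by rw [zero_smul]; exact ga4⟩
  · refine ⟨_, _, hwb _, (gb _).trans ?_⟩
    congr 1
    exact ((qpow_inj_iff hξ h0 hm.ne' _ _).2 (by convert hin using 1; ring)).symm
  · refine ⟨_, _, hwc _, (gc _).trans ?_⟩
    congr 1
    exact ((zpow_inj_iff hξ h0 _ _).2 (by convert hi using 1; ring)).symm
  · rcases lt_trichotomy k (n - l) with hk' | rfl | hk'
    · rcases k with _ | k
      · exact ⟨0, ⟨0, hk⟩, by rw [zero_smul]; exact hd1, by rw [zero_smul]; exact gd1⟩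
      · exact ⟨1, ⟨k, by omega⟩, by rw [one_smul]; exact hd2 k hk',
          by rw [one_smul]; exact gd2 k hk'⟩
    · exact ⟨0, ⟨0, by omega⟩, by rw [zero_smul]; exact hd3, by rw [zero_smul]; exact gd3⟩
    · obtain ⟨s, rfl⟩ : ∃ s, k = n - l + s + 1 := ⟨k - (n - l) - 1, by omega⟩
      exact ⟨1, ⟨n - l + s, by omega⟩, by rw [one_smul]; exact hd4 s (by omega),
        by rw [one_smul]; exact gd4 s (by omega)⟩

theorem exists_basis_of_isType (hξ : IsPrimitiveRoot ξ (m * n)) (hm : 1 < m) (hn : 1 < n)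
    [FiniteDimensional 𝕜 V] (hV : IsType 𝕜 m n ξ V 1 1) :
    ∃ (l : ℕ) (hl : 1 ≤ l ∧ l ≤ n - 1) (i : ℤ),
      (∃ e : Fin n → V, IsT1rep 𝕜 m n ξ l hl.1 (by omega) i e) ∨
      (∃ e : Fin n → V, IsT1barrep 𝕜 m n ξ l hl.1 (by omega) i e) := by
  have h0 : ξ ≠ 0 := hξ.ne_zero (by positivity)
  obtain ⟨-, hsoc, hquot⟩ := hV
  have hatom := isSimpleModule_iff_isAtom.1 (isSimpleModule_of_lengthIs hsoc)
  have hcoatom := isSimpleModule_iff_isCoatom.1 (isSimpleModule_of_lengthIs hquot)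
  have : IsArtinian (H 𝕜 m n ξ) V := isArtinian_of_tower 𝕜 inferInstance
  have hle : ∀ P : Submodule (H 𝕜 m n ξ) V, P ≠ ⊥ → socle 𝕜 m n ξ V ≤ P := by
    intro P hP
    obtain ⟨A, hA, hAP⟩ := (eq_bot_or_exists_atom_le P).resolve_left hP
    have hAS : A ≤ socle 𝕜 m n ξ V := le_sSup (isSimpleModule_iff_isAtom.2 hA)
    rwa [(hatom.le_iff_eq hA.1).1 hAS] at hAP
  have hR := rels_genEnd (V := V) (m := m) (n := n) (ξ := ξ)
  have hlift : ∀ P : Submodule 𝕜 V, IsStable (genEnd m n ξ V 0) (genEnd m n ξ V 1)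
      (genEnd m n ξ V 2) (genEnd m n ξ V 3) P →
      ∃ P' : Submodule (H 𝕜 m n ξ) V, P'.restrictScalars 𝕜 = P := by
    intro P hP
    refine ⟨{ P with
      smul_mem' := fun h x hx => smul_mem_of_gen_smul_mem P (fun k x hx => ?_) h hx }, rfl⟩
    fin_cases k
    exacts [(hP x hx).1, (hP x hx).2.1, (hP x hx).2.2.1, (hP x hx).2.2.2]
  set S := (socle 𝕜 m n ξ V).restrictScalars 𝕜 with hSdef
  have hS : IsStable (genEnd m n ξ V 0) (genEnd m n ξ V 1) (genEnd m n ξ V 2) (genEnd m n ξ V 3)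
      S := fun x hx =>
    have h := fun k => (socle 𝕜 m n ξ V).smul_mem (gen 𝕜 m n ξ k) hx
    ⟨h 0, h 1, h 2, h 3⟩
  have hS0 : S ≠ ⊥ := fun h => hatom.1 ((Submodule.restrictScalars_eq_bot_iff _ _ _).1 h)
  have hS1 : S ≠ ⊤ := fun h => hcoatom.1 ((Submodule.restrictScalars_eq_top_iff _ _ _).1 h)
  by_cases hker : LinearMap.ker (genEnd m n ξ V 3) ≤ S
  · have hmin : ∀ P, IsStable (genEnd m n ξ V 0) (genEnd m n ξ V 1) (genEnd m n ξ V 2)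
        (genEnd m n ξ V 3) P → P ≠ ⊥ → S ≤ P := by
      intro P hP hP0
      obtain ⟨P', rfl⟩ := hlift P hP
      exact hle P' fun h => hP0 ((Submodule.restrictScalars_eq_bot_iff _ _ _).2 h)
    obtain ⟨l, hl, i, e, h1, h2, h3, h4, h5, h6, h7, h8⟩ :=
      hR.exists_basis_T1 hξ h0 hm hn S hS hS0 hS1 hmin hker
    exact ⟨l, hl, i, Or.inl ⟨fun k => e k, h1, h2, h3, h4, fun k => h5 k k.2, fun k => h6 k k.2, h7,
      h8⟩⟩
  · obtain ⟨j, i, x, -, hdx, hxS, hx⟩ := hR.exists_wt_ker hξ h0 (by positivity) ⊤ S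
      (fun _ _ => Submodule.mem_top) (fun _ _ => Submodule.mem_top) (by rwa [top_inf_eq])
    have hmax : ∀ P, IsStable (genEnd m n ξ V 0) (genEnd m n ξ V 1) (genEnd m n ξ V 2)
        (genEnd m n ξ V 3) P → ¬ P ≤ S → P = ⊤ := by
      intro P hP hPS
      obtain ⟨P', rfl⟩ := hlift P hP
      have hP0 : P' ≠ ⊥ := by
        rintro rfl
        exact hPS (by simp)
      rw [Submodule.restrictScalars_eq_top_iff]
      exact hcoatom.2 _ (lt_of_le_not_ge (hle P' hP0) hPS)
    obtain ⟨l, hl, i, e, h1, h2, h3, h4, h5, h6, h7, h8, h9, h10, h11, h12⟩ :=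
      hR.exists_basis_T1bar hξ h0 (by omega) S hS hS0 hmax hx hdx hxS
    exact ⟨l, hl, i, Or.inr ⟨fun k => e k, h1, h2, h3, h4, h5, h6, fun k => h7 k k.2,
      fun k => h8 k k.2, h9, h10, h11, h12⟩⟩

end Transfer

/-- Proposition 4.12 and Lemma 4.11: every finite dimensional
indecomposable module of `(1,1)`-type is isomorphic to some `T_1(l,i)` or `T̄_1(l,i)`;
moreover `T_1(l,i) ≇ T̄_1(l',i')` always, `T_1(l,i) ≅ T_1(l',i')` iff `l = l'` and
`i ≡ i' (mod mn)`, and likewise for `T̄_1`. -/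
theorem statement18 (𝕜 : Type) [Field 𝕜] [IsAlgClosed 𝕜] (m n : ℕ) (hm : 1 < m) (hn : 1 < n)
    (ξ : 𝕜) (hξ : IsPrimitiveRoot ξ (m * n))
    (l l' : ℕ) (hl : 1 ≤ l ∧ l ≤ n - 1) (hl' : 1 ≤ l' ∧ l' ≤ n - 1) (i i' : ℤ) :
    (∀ (M : Type) [AddCommGroup M] [Module 𝕜 M] [Module (H 𝕜 m n ξ) M]
        [IsScalarTower 𝕜 (H 𝕜 m n ξ) M] [FiniteDimensional 𝕜 M],
      Indec 𝕜 m n ξ M → IsType 𝕜 m n ξ M 1 1 →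
      ∃ (l₀ : ℕ) (hrange : 1 ≤ l₀ ∧ l₀ ≤ n - 1) (i₀ : ℤ),
        (∃ e : Fin n → M, IsT1rep 𝕜 m n ξ l₀ hrange.1 (by omega) i₀ e) ∨
        (∃ e : Fin n → M, IsT1barrep 𝕜 m n ξ l₀ hrange.1 (by omega) i₀ e)) ∧
    (∀ (V W : Type) [AddCommGroup V] [Module 𝕜 V] [Module (H 𝕜 m n ξ) V]
        [IsScalarTower 𝕜 (H 𝕜 m n ξ) V] [AddCommGroup W] [Module 𝕜 W]
        [Module (H 𝕜 m n ξ) W] [IsScalarTower 𝕜 (H 𝕜 m n ξ) W]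
        (e : Fin n → V) (e' : Fin n → W),
      IsT1rep 𝕜 m n ξ l hl.1 (by omega) i e →
      IsT1barrep 𝕜 m n ξ l' hl'.1 (by omega) i' e' →
      ¬ Nonempty (V ≃ₗ[H 𝕜 m n ξ] W)) ∧
    (∀ (V W : Type) [AddCommGroup V] [Module 𝕜 V] [Module (H 𝕜 m n ξ) V]
        [IsScalarTower 𝕜 (H 𝕜 m n ξ) V] [AddCommGroup W] [Module 𝕜 W]
        [Module (H 𝕜 m n ξ) W] [IsScalarTower 𝕜 (H 𝕜 m n ξ) W]
        (e : Fin n → V) (e' : Fin n → W),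
      IsT1rep 𝕜 m n ξ l hl.1 (by omega) i e →
      IsT1rep 𝕜 m n ξ l' hl'.1 (by omega) i' e' →
      (Nonempty (V ≃ₗ[H 𝕜 m n ξ] W) ↔ l = l' ∧ Int.ModEq ((m : ℤ) * n) i i')) ∧
    (∀ (V W : Type) [AddCommGroup V] [Module 𝕜 V] [Module (H 𝕜 m n ξ) V]
        [IsScalarTower 𝕜 (H 𝕜 m n ξ) V] [AddCommGroup W] [Module 𝕜 W]
        [Module (H 𝕜 m n ξ) W] [IsScalarTower 𝕜 (H 𝕜 m n ξ) W]
        (e : Fin n → V) (e' : Fin n → W),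
      IsT1barrep 𝕜 m n ξ l hl.1 (by omega) i e →
      IsT1barrep 𝕜 m n ξ l' hl'.1 (by omega) i' e' →
      (Nonempty (V ≃ₗ[H 𝕜 m n ξ] W) ↔ l = l' ∧ Int.ModEq ((m : ℤ) * n) i i')) := by
  have h0 : ξ ≠ 0 := hξ.ne_zero (by positivity)
  have hm0 : 0 < m := by omega
  have hN : (2 * n : ℤ) ≤ m * n := by exact_mod_cast Nat.mul_le_mul_right n hm
  have hnd : ∀ z : ℤ, |z| < m * n → (m * n : ℤ) ∣ z → z = 0 := fun z hz h =>
    Int.eq_zero_of_abs_lt_dvd h hz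
  have hn1 : ∀ z : ℤ, |z| < n → (n : ℤ) ∣ z → z = 0 := fun z hz h =>
    Int.eq_zero_of_abs_lt_dvd h hz
  refine ⟨fun M _ _ _ _ _ _ hT => exists_basis_of_isType hξ hm hn hT, ?_, ?_, ?_⟩
  · rintro V W _ _ _ _ _ _ _ _ e e' h h' ⟨φ⟩
    obtain ⟨k, hk, hwd, -⟩ := h'.isWtBasis.exists_of_linearEquiv hξ h0 hm0 h.isWtBasis φ.symm
      ⟨0, by omega⟩ h'.2.2.2.2.2.2.2.2.1
    obtain ⟨k', hk', hd', -⟩ := h'.isWtBasis.exists_of_linearEquiv hξ h0 hm0 h.isWtBasis φ.symm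
      ⟨n - l', by omega⟩ h'.2.2.2.2.2.2.2.2.2.2.1
    rw [h.eq_zero_of_d hk] at hwd
    rw [h.eq_zero_of_d hk'] at hd'
    have := hnd _ (by rw [abs_lt]; dsimp only; constructor <;> omega) (dvd_sub hd' hwd)
    dsimp only at this
    omega
  · intro V W _ _ _ _ _ _ _ _ e e' h h'
    constructor
    · rintro ⟨φ⟩
      obtain ⟨k, hk, hwc, hwb⟩ := h.isWtBasis.exists_of_linearEquiv hξ h0 hm0 h'.isWtBasis φ
        ⟨0, by omega⟩ h.2.2.2.2.2.2.1
      rw [h'.eq_zero_of_d hk] at hwc hwb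
      simp only [Nat.cast_zero, add_zero, sub_zero] at hwc hwb
      refine ⟨?_, (Int.modEq_iff_dvd.2 hwc).symm⟩
      have := hn1 _ (by rw [abs_lt]; constructor <;> omega)
        (show (n : ℤ) ∣ l - l' by
          convert Int.dvd_sub hwb ((dvd_mul_left (n : ℤ) m).trans hwc) using 1; ring)
      omega
    · rintro ⟨rfl, hi⟩
      exact h.nonempty_linearEquiv hξ h0 hm0 h' (Int.modEq_iff_dvd.1 hi.symm)
  · intro V W _ _ _ _ _ _ _ _ e e' h h'
    constructor
    · rintro ⟨φ⟩
      obtain ⟨k, hk, hwc, hwb⟩ := h.isWtBasis.exists_of_linearEquiv hξ h0 hm0 h'.isWtBasis φ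
        ⟨0, by omega⟩ h.2.2.2.2.2.2.2.2.1
      obtain ⟨k', hk', hc', -⟩ := h.isWtBasis.exists_of_linearEquiv hξ h0 hm0 h'.isWtBasis φ
        ⟨n - l, by omega⟩ h.2.2.2.2.2.2.2.2.2.2.1
      have hcc := dvd_sub hc' hwc
      rcases h'.eq_of_d hk with hk0 | hk0
      · rw [hk0] at hwc hwb
        simp only [Nat.cast_zero, add_zero, sub_zero] at hwc hwb
        have := hn1 _ (by rw [abs_lt]; constructor <;> omega) (show (n : ℤ) ∣ l - l' by
          convert Int.dvd_sub ((dvd_mul_left (n : ℤ) m).trans hwc) hwb using 1; ring)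
        obtain rfl : l = l' := by omega
        refine ⟨rfl, (Int.modEq_iff_dvd.2 ?_).symm⟩
        convert hwc using 1
        ring
      · exfalso
        have := hnd _ (by
          rw [abs_lt]; dsimp only
          rcases h'.eq_of_d hk' with hk0' | hk0' <;> constructor <;> omega) hcc
        dsimp only at this
        rcases h'.eq_of_d hk' with hk0' | hk0' <;> omega
    · rintro ⟨rfl, hi⟩
      exact h.nonempty_linearEquiv hξ h0 hm0 h' (Int.modEq_iff_dvd.1 hi.symm)

end Radford
end
end
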